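/- For every finite set X and every set C of 3-colorings of X, there exists a graph G with X ⊆ V(G) that is X-rooted-K₄-minor-free and K₅-minor-free and realizes C: a function f : X → {1,2,3} extends to a proper 3-coloring of G if and only if f ∈ C. -/

import Mathlib

/-- `c` is a proper coloring of `G`. -/
def IsProperColoring {V α : Type*} (G : SimpleGraph V) (c : V → α) : Prop :=
  ∀ ⦃x y⦄, G.Adj x y → c x ≠ c y

/-- `G` has a `K_m` minor, expressed via a minor model. -/
def HasCliqueMinor {V : Type*} (G : SimpleGraph V) (m : ℕ) : Prop :=
  ∃ μ : Fin m → Set V,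
    (∀ i, (μ i).Nonempty ∧ (G.induce (μ i)).Connected) ∧
    (∀ i j, i ≠ j → Disjoint (μ i) (μ j)) ∧
    (∀ i j, i ≠ j → ∃ a ∈ μ i, ∃ b ∈ μ j, G.Adj a b)

/-- `G` has an `X`-rooted `K_m` minor: a minor model of `K_m` each of whose
branch sets meets `X`. -/
def HasRootedCliqueMinor {V : Type*} (G : SimpleGraph V) (X : Set V) (m : ℕ) : Prop :=
  ∃ μ : Fin m → Set V,
    (∀ i, (μ i ∩ X).Nonempty ∧ (G.induce (μ i)).Connected) ∧
    (∀ i j, i ≠ j → Disjoint (μ i) (μ j)) ∧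
    (∀ i j, i ≠ j → ∃ a ∈ μ i, ∃ b ∈ μ j, G.Adj a b)

namespace RR

open Finset

/-- first end of the `p`-th edge of `K₅` -/
def ea : Fin 10 → Fin 5 := ![0,0,0,0,1,1,1,2,2,3]
/-- second end of the `p`-th edge of `K₅` -/
def eb : Fin 10 → Fin 5 := ![1,2,3,4,2,3,4,3,4,4]

/-- incidence of `K₅` -/
def inc5 (i : Fin 5) (p : Fin 10) : ZMod 2 := if ea p = i ∨ eb p = i then 1 else 0

lemma z2_eq_one {x : ZMod 2} (h : x ≠ 0) : x = 1 := by
  revert x; decide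

lemma z2_two : (2 : ZMod 2) = 0 := by decide

lemma even_other (y : Fin 10 → ZMod 2) (i : Fin 5) (hy : ∑ p, y p * inc5 i p = 0)
    (p : Fin 10) (hp : y p ≠ 0) (hi : inc5 i p ≠ 0) :
    ∃ p', p' ≠ p ∧ y p' ≠ 0 ∧ inc5 i p' ≠ 0 := by
  by_contra hcon
  push Not at hcon
  rw [Finset.sum_eq_single p] at hy
  · exact (mul_ne_zero hp hi) hy
  · intro b _ hb
    by_cases h : y b = 0
    · simp [h]
    · simp [hcon b hb h]
  · simp

lemma even_card (y : Fin 10 → ZMod 2) (hy : ∀ i, ∑ p, y p * inc5 i p = 0)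
    (h0 : y ≠ 0) : 3 ≤ (univ.filter (fun p => y p ≠ 0)).card := by
  obtain ⟨p, hp⟩ := Function.ne_iff.mp h0
  simp only [Pi.zero_apply] at hp
  have h1 : inc5 (ea p) p ≠ 0 := by simp [inc5]
  have h2 : inc5 (eb p) p ≠ 0 := by simp [inc5]
  obtain ⟨q, hq, hyq, hiq⟩ := even_other y _ (hy (ea p)) p hp h1
  obtain ⟨r, hr, hyr, hir⟩ := even_other y _ (hy (eb p)) p hp h2
  have key : ∀ p q : Fin 10, q ≠ p → inc5 (ea p) q ≠ 0 → inc5 (eb p) q ≠ 0 → False := by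
    decide
  have hqr : q ≠ r := by
    rintro rfl
    exact key p q hq hiq hir
  have : ({p, q, r} : Finset (Fin 10)).card = 3 := by
    rw [Finset.card_eq_three]
    exact ⟨p, q, r, hq.symm, hr.symm, hqr, rfl⟩
  rw [← this]
  apply Finset.card_le_card
  intro x hx
  simp only [Finset.mem_insert, Finset.mem_singleton] at hx
  rcases hx with rfl | rfl | rfl <;> simp [hp, hyq, hyr]

lemma k5_count {Q : Type} [Fintype Q] [DecidableEq Q] (m : Q → Fin 10 → ZMod 2)
    (even : ∀ q i, ∑ p, m q p * inc5 i p = 0) (hs : ∀ p, ∑ q, m q p = 0)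
    (two : ∀ p, (univ.filter (fun q => m q p ≠ 0)).card ≤ 2)
    (span : ∀ y : Fin 10 → ZMod 2, (∀ i, ∑ p, y p * inc5 i p = 0) →
      ∃ b : Q → ZMod 2, ∀ p, y p = ∑ q, b q * m q p) : False := by
  set J : Finset Q := univ.filter (fun q => m q ≠ 0) with hJ
  have hcard : J.card ≤ 6 := by
    have h1 : ∑ q ∈ J, 3 ≤ ∑ q ∈ J, (univ.filter (fun p => m q p ≠ 0)).card := by
      apply Finset.sum_le_sum
      intro q hq
      exact even_card _ (even q) (by simpa [hJ] using hq)
    have h2 : ∑ q ∈ J, (univ.filter (fun p => m q p ≠ 0)).card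
        ≤ ∑ q, (univ.filter (fun p => m q p ≠ 0)).card :=
      Finset.sum_le_sum_of_subset (Finset.subset_univ _)
    have h3 : ∑ q, (univ.filter (fun p => m q p ≠ 0)).card
        = ∑ p, (univ.filter (fun q => m q p ≠ 0)).card := by
      simp only [Finset.card_filter]
      exact Finset.sum_comm
    have h4 : ∑ p, (univ.filter (fun q => m q p ≠ 0)).card ≤ ∑ p : Fin 10, 2 :=
      Finset.sum_le_sum (fun p _ => two p)
    simp only [Finset.sum_const, smul_eq_mul, Finset.card_univ, Fintype.card_fin] at h1 h4
    omega
  -- the span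
  have hgen : ∃ K : Finset Q, K.card ≤ 5 ∧ ∀ b : Q → ZMod 2, ∃ b' : Q → ZMod 2, ∀ p,
      ∑ q, b q * m q p = ∑ q ∈ K, b' q * m q p := by
    have hJsum : ∀ (b : Q → ZMod 2) p, ∑ q, b q * m q p = ∑ q ∈ J, b q * m q p := by
      intro b p
      symm
      apply Finset.sum_subset (Finset.subset_univ _)
      intro q _ hq
      have : m q = 0 := by simpa [hJ] using hq
      simp [this]
    rcases J.eq_empty_or_nonempty with h | ⟨q0, hq0⟩
    · refine ⟨∅, by simp, fun b => ⟨b, fun p => ?_⟩⟩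
      rw [hJsum, h]
    · refine ⟨J.erase q0, ?_, fun b => ⟨fun q => b q - b q0, fun p => ?_⟩⟩
      · rw [Finset.card_erase_of_mem hq0]; omega
      · have h1 := hJsum (fun _ => b q0) p
        have h2 := hJsum b p
        have h3 : ∑ q, b q0 * m q p = 0 := by
          rw [← Finset.mul_sum, hs, mul_zero]
        rw [h2, ← sub_zero (∑ q ∈ J, b q * m q p), ← h3, h1, ← Finset.sum_sub_distrib,
          ← Finset.add_sum_erase _ _ hq0]
        simp [sub_mul]
  obtain ⟨K, hK, hgen⟩ := hgen
  -- surjection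
  let φ : (K → ZMod 2) →ₗ[ZMod 2] (Fin 6 → ZMod 2) :=
    { toFun := fun b j => ∑ q : K, b q * m q (Fin.natAdd 4 j)
      map_add' := by
        intro x y; ext j; simp [add_mul, Finset.sum_add_distrib]
      map_smul' := by
        intro c x; ext j; simp [Finset.mul_sum, mul_assoc] }
  have hsurj : Function.Surjective φ := by
    intro t
    let y : Fin 10 → ZMod 2 := ![t 0 + t 1 + t 2, t 0 + t 3 + t 4, t 1 + t 3 + t 5,
      t 2 + t 4 + t 5, t 0, t 1, t 2, t 3, t 4, t 5]
    have hy : ∀ i, ∑ p, y p * inc5 i p = 0 := by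
      intro i
      simp only [Fin.sum_univ_succ, y, inc5, ea, eb]
      generalize t 0 = a0
      generalize t 1 = a1
      generalize t 2 = a2
      generalize t 3 = a3
      generalize t 4 = a4
      generalize t 5 = a5
      fin_cases i <;> simp <;> revert a0 a1 a2 a3 a4 a5 <;> decide
    obtain ⟨b, hb⟩ := span y hy
    obtain ⟨b', hb'⟩ := hgen b
    refine ⟨fun q => b' q, ?_⟩
    ext j
    have h1 := hb (Fin.natAdd 4 j)
    rw [hb'] at h1
    have h2 : y (Fin.natAdd 4 j) = t j := by
      fin_cases j <;> rfl
    rw [← h2, h1]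
    simp only [φ, LinearMap.coe_mk, AddHom.coe_mk]
    exact Finset.sum_coe_sort K (fun q => b' q * m q (Fin.natAdd 4 j))
  have := LinearMap.finrank_le_finrank_of_surjective hsurj
  simp at this
  omega

end RR
namespace RR

open Finset

/-- `z` is a cycle mod 2 (pairs to zero with every coboundary) -/
def IsCyc {V E : Type} [Fintype E] (src tgt : E → V) (z : E → ZMod 2) : Prop :=
  ∀ h : V → ZMod 2, ∑ e, z e * (h (src e) + h (tgt e)) = 0

/-- `e` joins `x` and `y` -/
def Joins {V E : Type} (src tgt : E → V) (e : E) (x y : V) : Prop :=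
  (src e = x ∧ tgt e = y) ∨ (src e = y ∧ tgt e = x)

lemma path_lemma {V E : Type} [Fintype E] [DecidableEq E] (src tgt : E → V) (G : SimpleGraph V)
    (hG : ∀ x y, G.Adj x y → ∃ e, Joins src tgt e x y) (S : Set V) (u v : S)
    (hr : (G.induce S).Reachable u v) :
    ∃ z : E → ZMod 2, (∀ e, z e ≠ 0 → src e ∈ S ∧ tgt e ∈ S) ∧
      ∀ h : V → ZMod 2, ∑ e, z e * (h (src e) + h (tgt e)) = h u + h v := by
  obtain ⟨w⟩ := hr
  induction w with
  | nil => exact ⟨0, by simp, fun h => by simp [CharTwo.add_self_eq_zero]⟩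
  | @cons u w v hadj _ ih =>
    obtain ⟨z, hz1, hz2⟩ := ih
    obtain ⟨e, he⟩ := hG u w (by simpa using hadj)
    refine ⟨fun e' => z e' + (if e' = e then 1 else 0), ?_, ?_⟩
    · intro e' he'
      by_cases h : e' = e
      · subst h
        rcases he with ⟨h1, h2⟩ | ⟨h1, h2⟩ <;> rw [h1, h2] <;> simp
      · simp [h] at he'
        exact hz1 _ he'
    · intro h
      simp only [add_mul, Finset.sum_add_distrib, hz2]
      simp only [ite_mul, one_mul, zero_mul, Finset.sum_ite_eq', Finset.mem_univ, if_true]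
      rcases he with ⟨h1, h2⟩ | ⟨h1, h2⟩ <;> rw [h1, h2] <;>
        linear_combination (h w) * z2_two

lemma pair_sum {E F : Type} [Fintype F] [DecidableEq F] (M : F → E → ZMod 2) (e : E)
    (two : (univ.filter (fun f => M f e ≠ 0)).card ≤ 2) (f f' : F) (hne : f ≠ f')
    (hf : M f e ≠ 0) (hf' : M f' e ≠ 0) (a : F → ZMod 2) :
    ∑ g, a g * M g e = a f + a f' := by
  have hset : ({f, f'} : Finset F) = univ.filter (fun f => M f e ≠ 0) := by
    apply Finset.eq_of_subset_of_card_le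
    · intro x hx
      simp only [Finset.mem_insert, Finset.mem_singleton] at hx
      rcases hx with rfl | rfl <;> simp [hf, hf']
    · rw [Finset.card_pair hne]; exact two
  have h1 : ∑ g, a g * M g e = ∑ g ∈ ({f, f'} : Finset F), a g * M g e := by
    symm
    apply Finset.sum_subset (Finset.subset_univ _)
    intro x _ hx
    rw [hset] at hx
    have : M x e = 0 := by simpa using hx
    simp [this]
  rw [h1, Finset.sum_pair hne, z2_eq_one hf, z2_eq_one hf']
  ring

theorem noK5_closed {V E F : Type} [Fintype E] [Fintype F] [DecidableEq E]
    (src tgt : E → V) (M : F → E → ZMod 2) (hs : ∀ e, ∑ f, M f e = 0)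
    (two : ∀ e, (univ.filter (fun f => M f e ≠ 0)).card ≤ 2)
    (cyc : ∀ f, IsCyc src tgt (M f))
    (H1 : ∀ z, IsCyc src tgt z → ∃ a : F → ZMod 2, ∀ e, z e = ∑ f, a f * M f e)
    (G : SimpleGraph V) (hG : ∀ x y, G.Adj x y → ∃ e, Joins src tgt e x y) :
    ¬ HasCliqueMinor G 5 := by
  classical
  rintro ⟨μ, hμ, hdis, hadj⟩
  have hu : ∀ x i j, x ∈ μ i → x ∈ μ j → i = j := by
    intro x i j hi hj
    by_contra hne
    exact Set.disjoint_left.mp (hdis i j hne) hi hj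
  have hends : ∀ p : Fin 10, ea p ≠ eb p := by decide
  have hex : ∀ p : Fin 10, ∃ e, ∃ a ∈ μ (ea p), ∃ b ∈ μ (eb p), Joins src tgt e a b := by
    intro p
    obtain ⟨a, ha, b, hb, hab⟩ := hadj (ea p) (eb p) (hends p)
    obtain ⟨e, he⟩ := hG a b hab
    exact ⟨e, a, ha, b, hb, he⟩
  choose d a ha b hb hd using hex
  have hdinj : Function.Injective d := by
    intro p q hpq
    have key : ∀ p q : Fin 10, (ea p = ea q ∧ eb p = eb q) ∨ (ea p = eb q ∧ eb p = ea q) →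
        p = q := by decide
    apply key
    have h1 := hd p
    have h2 := hd q
    have hap := ha p
    have hbp := hb p
    have haq := ha q
    have hbq := hb q
    rw [← hpq] at h2
    rcases h1 with ⟨h1, h1'⟩ | ⟨h1, h1'⟩ <;> rcases h2 with ⟨h2, h2'⟩ | ⟨h2, h2'⟩ <;>
      rw [h1] at h2 <;> rw [h1'] at h2'
    · rw [← h2] at haq; rw [← h2'] at hbq
      exact Or.inl ⟨hu _ _ _ hap haq, hu _ _ _ hbp hbq⟩
    · rw [← h2] at hbq; rw [← h2'] at haq
      exact Or.inr ⟨hu _ _ _ hap hbq, hu _ _ _ hbp haq⟩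
    · rw [← h2] at haq; rw [← h2'] at hbq
      exact Or.inr ⟨hu _ _ _ hap hbq, hu _ _ _ hbp haq⟩
    · rw [← h2] at hbq; rw [← h2'] at haq
      exact Or.inl ⟨hu _ _ _ hap haq, hu _ _ _ hbp hbq⟩
  let inB : E → Prop := fun e => ∃ i, src e ∈ μ i ∧ tgt e ∈ μ i
  have hdB : ∀ p, ¬ inB (d p) := by
    rintro p ⟨i, h1, h2⟩
    apply hends p
    rcases hd p with ⟨h3, h4⟩ | ⟨h3, h4⟩
    · rw [h3] at h1; rw [h4] at h2
      rw [hu _ _ _ (ha p) h1, hu _ _ _ (hb p) h2]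
    · rw [h3] at h1; rw [h4] at h2
      rw [hu _ _ _ (hb p) h1, hu _ _ _ (ha p) h2]
  -- the edges to be deleted
  let isR : E → Prop := fun e => ¬ inB e ∧ ∀ p, e ≠ d p
  let Rr : F → F → Prop := fun f f' => ∃ e, isR e ∧ M f e ≠ 0 ∧ M f' e ≠ 0
  have : Fintype (Quot Rr) := Fintype.ofFinite _
  let m : Quot Rr → Fin 10 → ZMod 2 := fun q p => ∑ f, if Quot.mk Rr f = q then M f (d p) else 0
  -- a cycle vanishing on R-edges restricts to an even set
  have heven : ∀ z : E → ZMod 2, IsCyc src tgt z → (∀ e, isR e → z e = 0) →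
      ∀ i, ∑ p, z (d p) * inc5 i p = 0 := by
    intro z hz hR i
    have h1 := hz (fun v => if v ∈ μ i then 1 else 0)
    rw [← h1]
    rw [← Finset.sum_subset (Finset.subset_univ (univ.map ⟨d, hdinj⟩))]
    · rw [Finset.sum_map]
      apply Finset.sum_congr rfl
      intro p _
      congr 1
      have e1 : (a p ∈ μ i) ↔ ea p = i :=
        ⟨fun h => hu _ _ _ (ha p) h, fun h => h ▸ ha p⟩
      have e2 : (b p ∈ μ i) ↔ eb p = i :=
        ⟨fun h => hu _ _ _ (hb p) h, fun h => h ▸ hb p⟩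
      have hne := hends p
      simp only [Function.Embedding.coeFn_mk, inc5]
      rcases hd p with ⟨h3, h4⟩ | ⟨h3, h4⟩ <;> simp only [h3, h4, e1, e2] <;>
        by_cases c1 : ea p = i <;> by_cases c2 : eb p = i <;> simp [c1, c2] <;>
        exact hne (c1.trans c2.symm)
    · intro e _ he
      have he' : ∀ p, e ≠ d p := by
        intro p hp
        apply he
        simp [hp]
      by_cases hB : inB e
      · obtain ⟨j, hj1, hj2⟩ := hB
        have e1 : (src e ∈ μ i) ↔ j = i :=
          ⟨fun h => hu _ _ _ hj1 h, fun h => h ▸ hj1⟩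
        have e2 : (tgt e ∈ μ i) ↔ j = i :=
          ⟨fun h => hu _ _ _ hj2 h, fun h => h ▸ hj2⟩
        simp only [e1, e2, CharTwo.add_self_eq_zero, mul_zero]
      · rw [hR e ⟨hB, he'⟩, zero_mul]
  have cycsum : ∀ c : F → ZMod 2, IsCyc src tgt (fun e => ∑ f, c f * M f e) := by
    intro c h
    simp only [Finset.sum_mul]
    rw [Finset.sum_comm]
    apply Finset.sum_eq_zero
    intro f _
    have := cyc f h
    simp only [mul_assoc]
    rw [← Finset.mul_sum, this, mul_zero]
  refine k5_count m ?_ ?_ ?_ ?_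
  · intro q i
    have h1 := heven _ (cycsum (fun f => if Quot.mk Rr f = q then 1 else 0)) ?_ i
    · simpa [m] using h1
    · intro e he
      by_cases hall : ∀ f, M f e = 0
      · simp [hall]
      · push Not at hall
        obtain ⟨f, hf⟩ := hall
        have hex : ∃ f', f' ≠ f ∧ M f' e ≠ 0 := by
          by_contra hcon
          push Not at hcon
          have := hs e
          rw [Finset.sum_eq_single f (fun b _ hb => hcon b hb) (by simp)] at this
          exact hf this
        obtain ⟨f', hne, hf'⟩ := hex
        rw [pair_sum M e (two e) f f' hne.symm hf hf']
        have : Quot.mk Rr f = Quot.mk Rr f' := Quot.sound ⟨e, he, hf, hf'⟩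
        rw [this, CharTwo.add_self_eq_zero]
  · intro p
    simp only [m]
    rw [Finset.sum_comm]
    simp [hs]
  · intro p
    refine le_trans (Finset.card_le_card ?_)
      (le_trans (Finset.card_image_le (f := Quot.mk Rr)) (two (d p)))
    intro q hq
    have hq' : m q p ≠ 0 := by simpa using hq
    obtain ⟨f, _, hf⟩ := Finset.exists_ne_zero_of_sum_ne_zero hq'
    by_cases h : Quot.mk Rr f = q
    · rw [if_pos h] at hf
      simp only [Finset.mem_image, Finset.mem_filter, Finset.mem_univ, true_and]
      exact ⟨f, hf, h⟩
    · simp [h] at hf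
  · intro y hy
    have hroot : ∀ i, ∃ r, r ∈ μ i := fun i => (hμ i).1
    choose r hr using hroot
    have hpath : ∀ i, ∀ u ∈ μ i, ∃ z : E → ZMod 2, (∀ e, z e ≠ 0 → src e ∈ μ i ∧ tgt e ∈ μ i) ∧
        ∀ h : V → ZMod 2, ∑ e, z e * (h (src e) + h (tgt e)) = h (r i) + h u := by
      intro i u hui
      exact path_lemma src tgt G hG (μ i) ⟨r i, hr i⟩ ⟨u, hui⟩
        ((hμ i).2.preconnected _ _)
    choose π hπ1 hπ2 using hpath
    let w : Fin 10 → E → ZMod 2 := fun p e =>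
      (if e = d p then 1 else 0) + π (ea p) (a p) (ha p) e + π (eb p) (b p) (hb p) e
    have hw0 : ∀ p e, ¬ inB e → w p e = if e = d p then 1 else 0 := by
      intro p e he
      have h1 : π (ea p) (a p) (ha p) e = 0 := by
        by_contra h
        exact he ⟨_, hπ1 _ _ _ _ h⟩
      have h2 : π (eb p) (b p) (hb p) e = 0 := by
        by_contra h
        exact he ⟨_, hπ1 _ _ _ _ h⟩
      simp [w, h1, h2]
    have hwh : ∀ p (h : V → ZMod 2), ∑ e, w p e * (h (src e) + h (tgt e))
        = h (r (ea p)) + h (r (eb p)) := by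
      intro p h
      simp only [w, add_mul, Finset.sum_add_distrib, hπ2]
      simp only [ite_mul, one_mul, zero_mul, Finset.sum_ite_eq', Finset.mem_univ, if_true]
      rcases hd p with ⟨h3, h4⟩ | ⟨h3, h4⟩ <;> rw [h3, h4] <;>
        linear_combination (h (a p) + h (b p)) * z2_two
    let z : E → ZMod 2 := fun e => ∑ p, y p * w p e
    have hzc : IsCyc src tgt z := by
      intro h
      simp only [z, Finset.sum_mul]
      rw [Finset.sum_comm]
      simp only [mul_assoc]
      simp only [← Finset.mul_sum, hwh]
      have e1 : ∀ p, h (r (ea p)) + h (r (eb p)) = ∑ i, h (r i) * inc5 i p := by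
        intro p
        have hne := hends p
        rw [← Finset.sum_subset (Finset.subset_univ {ea p, eb p}), Finset.sum_pair hne]
        · simp [inc5]
        · intro i _ hi
          simp only [Finset.mem_insert, Finset.mem_singleton, not_or] at hi
          simp [inc5, Ne.symm hi.1, Ne.symm hi.2]
      simp only [e1, Finset.mul_sum]
      rw [Finset.sum_comm]
      apply Finset.sum_eq_zero
      intro i _
      have := hy i
      calc ∑ p, y p * (h (r i) * inc5 i p) = h (r i) * ∑ p, y p * inc5 i p := by
            rw [Finset.mul_sum]
            exact Finset.sum_congr rfl (fun p _ => by ring)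
        _ = 0 := by rw [this, mul_zero]
    obtain ⟨c, hc⟩ := H1 z hzc
    have hcR : ∀ f f', Rr f f' → c f = c f' := by
      rintro f f' ⟨e, he, hf, hf'⟩
      by_cases hff : f = f'
      · rw [hff]
      have h1 := hc e
      rw [pair_sum M e (two e) f f' hff hf hf'] at h1
      have h2 : z e = 0 := by
        apply Finset.sum_eq_zero
        intro p _
        rw [hw0 p e he.1, if_neg (he.2 p), mul_zero]
      rw [h2] at h1
      exact CharTwo.add_eq_zero.mp h1.symm
    refine ⟨Quot.lift c hcR, fun p => ?_⟩
    have h1 : z (d p) = y p := by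
      simp only [z]
      rw [Finset.sum_eq_single p]
      · rw [hw0 p _ (hdB p), if_pos rfl, mul_one]
      · intro q _ hq
        rw [hw0 q _ (hdB p), if_neg (fun h => hq (hdinj h).symm), mul_zero]
      · simp
    rw [← h1, hc]
    simp only [m, Finset.mul_sum]
    rw [Finset.sum_comm]
    apply Finset.sum_congr rfl
    intro f _
    rw [Finset.sum_eq_single (Quot.mk Rr f)]
    · simp
    · intro q _ hq
      rw [if_neg hq.symm, mul_zero]
    · simp

theorem noK5 {V E F : Type} [Fintype E] [Fintype F] [DecidableEq E]
    (src tgt : E → V) (M : F → E → ZMod 2)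
    (two : ∀ e, (∑ f, if M f e ≠ 0 then 1 else 0) ≤ 2)
    (cyc : ∀ f, IsCyc src tgt (M f))
    (H1 : ∀ z, IsCyc src tgt z → ∃ a : F → ZMod 2, ∀ e, z e = ∑ f, a f * M f e)
    (G : SimpleGraph V) (hG : ∀ x y, G.Adj x y → ∃ e, Joins src tgt e x y) :
    ¬ HasCliqueMinor G 5 := by
  classical
  refine noK5_closed src tgt (F := Option F) (fun o e => o.elim (∑ f, M f e) (fun f => M f e))
    ?_ ?_ ?_ ?_ G hG
  · intro e
    simp [Fintype.sum_option, CharTwo.add_self_eq_zero]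
  · intro e
    have hM : ∀ f, M f e = ((if M f e ≠ 0 then 1 else 0 : ℕ) : ZMod 2) := by
      intro f
      by_cases h : M f e = 0
      · simp [h]
      · simp [z2_eq_one h]
    have h2 := two e
    rw [Finset.card_filter, Fintype.sum_option]
    simp only [Option.elim]
    have hsum : ∑ f, M f e = ((∑ f, if M f e ≠ 0 then 1 else 0 : ℕ) : ZMod 2) := by
      rw [Nat.cast_sum]
      exact Finset.sum_congr rfl (fun f _ => hM f)
    have key : (if (∑ f, M f e) ≠ 0 then 1 else 0) + (∑ f, if M f e ≠ 0 then 1 else 0) ≤ 2 := by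
      rw [hsum]
      generalize (∑ f, if M f e ≠ 0 then 1 else 0) = k at *
      interval_cases k
      · simp
      · simp
      · have : ((2 : ℕ) : ZMod 2) = 0 := by decide
        rw [this]; simp
    convert key
    all_goals congr
  · rintro (_ | f)
    · intro h
      simp only [Option.elim, Finset.sum_mul]
      rw [Finset.sum_comm]
      exact Finset.sum_eq_zero (fun f _ => cyc f h)
    · exact cyc f
  · intro z hz
    obtain ⟨c, hc⟩ := H1 z hz
    refine ⟨fun o => o.elim 0 c, fun e => ?_⟩
    rw [hc, Fintype.sum_option]
    simp

end RR
namespace RR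

open Finset

/-- the list of edges `b` runs along the list of vertices `L` -/
def Links {E : Type} (src tgt : E → ℕ) : List ℕ → List E → Prop
  | [_], [] => True
  | x :: y :: L, e :: b => src e = x ∧ tgt e = y ∧ Links src tgt (y :: L) b
  | _, _ => False

lemma links_split {E : Type} (src tgt : E → ℕ) (x y : ℕ) (q : List ℕ) :
    ∀ (p : List ℕ) (b : List E), Links src tgt (p ++ x :: y :: q) b →
      ∃ b1 e b2, b = b1 ++ e :: b2 ∧ Links src tgt (p ++ [x]) b1 ∧ src e = x ∧ tgt e = y ∧
        Links src tgt (y :: q) b2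
  | [], b, h => by
    cases b with
    | nil => simp [Links] at h
    | cons e b =>
      obtain ⟨h1, h2, h3⟩ := h
      exact ⟨[], e, b, rfl, trivial, h1, h2, h3⟩
  | u :: p, b, h => by
    cases b with
    | nil => cases p <;> simp [Links] at h
    | cons e b =>
      cases p with
      | nil =>
        obtain ⟨h1, h2, h3⟩ := h
        obtain ⟨b1, e', b2, rfl, g1, g2, g3, g4⟩ := links_split src tgt x y q [] b h3
        exact ⟨e :: b1, e', b2, rfl, ⟨h1, h2, g1⟩, g2, g3, g4⟩
      | cons v p =>
        obtain ⟨h1, h2, h3⟩ := h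
        obtain ⟨b1, e', b2, rfl, g1, g2, g3, g4⟩ := links_split src tgt x y q (v :: p) b h3
        exact ⟨e :: b1, e', b2, rfl, ⟨h1, h2, g1⟩, g2, g3, g4⟩

lemma links_join {E : Type} (src tgt : E → ℕ) (x : ℕ) (q : List ℕ) (b2 : List E)
    (hq : Links src tgt (x :: q) b2) :
    ∀ (p : List ℕ) (b1 : List E), Links src tgt (p ++ [x]) b1 →
      Links src tgt (p ++ x :: q) (b1 ++ b2)
  | [], b, h => by
    cases b with
    | nil => exact hq
    | cons e b => simp [Links] at h
  | u :: p, b, h => by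
    cases b with
    | nil => cases p <;> simp [Links] at h
    | cons e b =>
      cases p with
      | nil =>
        obtain ⟨h1, h2, h3⟩ := h
        exact ⟨h1, h2, links_join src tgt x q b2 hq [] b h3⟩
      | cons v p =>
        obtain ⟨h1, h2, h3⟩ := h
        exact ⟨h1, h2, links_join src tgt x q b2 hq (v :: p) b h3⟩

lemma links_map {E E' : Type} (src tgt : E → ℕ) (src' tgt' : E' → ℕ) (ι : E → E')
    (hs : ∀ e, src' (ι e) = src e) (ht : ∀ e, tgt' (ι e) = tgt e) :
    ∀ (L : List ℕ) (b : List E), Links src tgt L b → Links src' tgt' L (b.map ι)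
  | [], b, h => by cases b <;> simp [Links] at h
  | [x], b, h => by
    cases b with
    | nil => trivial
    | cons e b => simp [Links] at h
  | x :: y :: L, b, h => by
    cases b with
    | nil => simp [Links] at h
    | cons e b =>
      obtain ⟨h1, h2, h3⟩ := h
      exact ⟨(hs e).trans h1, (ht e).trans h2,
        links_map src tgt src' tgt' ι hs ht (y :: L) b h3⟩

/-- combinatorial planarity certificate of a disc with boundary path `L` -/
def HasCert (N : ℕ) (A : ℕ → ℕ → Prop) (L : List ℕ) : Prop :=
  ∃ (E F : Type) (_ : Fintype E) (_ : Fintype F) (_ : DecidableEq E) (src tgt : E → ℕ)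
    (M : F → E → ZMod 2) (b : List E),
    b.Nodup ∧ (∀ e, src e < N ∧ tgt e < N) ∧
    (∀ e, (∑ f, if M f e = 0 then 0 else 1) + (if e ∈ b then 1 else 0) ≤ 2) ∧
    (∀ f, IsCyc src tgt (M f)) ∧
    (∀ z, IsCyc src tgt z → ∃ a : F → ZMod 2, ∀ e, z e = ∑ f, a f * M f e) ∧
    Links src tgt L b ∧
    (∀ x y, A x y → ∃ e, Joins src tgt e x y)

lemma HasCert.noK5 {N : ℕ} {A : ℕ → ℕ → Prop} {L : List ℕ} (h : HasCert N A L)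
    (G : SimpleGraph ℕ) (hG : ∀ x y, G.Adj x y → A x y) : ¬ HasCliqueMinor G 5 := by
  obtain ⟨E, F, _, _, _, src, tgt, M, b, -, -, two, cyc, H1, -, hA⟩ := h
  exact RR.noK5 src tgt M (fun e => le_trans (by simp) (le_trans (Nat.le_add_right _ _) (two e))) cyc H1 G
    (fun x y hxy => hA x y (hG x y hxy))

lemma HasCert.mono {N : ℕ} {A A' : ℕ → ℕ → Prop} {L : List ℕ} (h : HasCert N A L)
    (hA' : ∀ x y, A' x y → A x y) : HasCert N A' L := by
  obtain ⟨E, F, i1, i2, i3, src, tgt, M, b, h1, h2, two, cyc, H1, h3, hA⟩ := h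
  exact ⟨E, F, i1, i2, i3, src, tgt, M, b, h1, h2, two, cyc, H1, h3,
    fun x y h => hA x y (hA' x y h)⟩

lemma HasCert.adj {N : ℕ} {A : ℕ → ℕ → Prop} {p q : List ℕ} {x y : ℕ}
    (h : HasCert N A (p ++ x :: y :: q)) :
    HasCert N (fun u v => A u v ∨ (u = x ∧ v = y) ∨ (u = y ∧ v = x)) (p ++ x :: y :: q) := by
  obtain ⟨E, F, i1, i2, i3, src, tgt, M, b, h1, h2, two, cyc, H1, h3, hA⟩ := h
  refine ⟨E, F, i1, i2, i3, src, tgt, M, b, h1, h2, two, cyc, H1, h3, ?_⟩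
  obtain ⟨b1, e, b2, -, -, g2, g3, -⟩ := links_split _ _ _ _ _ _ _ h3
  rintro u v (h | ⟨rfl, rfl⟩ | ⟨rfl, rfl⟩)
  · exact hA u v h
  · exact ⟨e, Or.inl ⟨g2, g3⟩⟩
  · exact ⟨e, Or.inr ⟨g2, g3⟩⟩

lemma HasCert.start : HasCert 2 (fun _ _ => False) [0, 1] := by
  refine ⟨Unit, Empty, inferInstance, inferInstance, inferInstance, fun _ => 0, fun _ => 1,
    fun f => f.elim, [()], by simp, by simp, by simp, fun f => f.elim, ?_, ⟨rfl, rfl, trivial⟩,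
    by simp⟩
  intro z hz
  refine ⟨fun f => f.elim, fun e => ?_⟩
  have := hz (fun v => if v = 0 then 1 else 0)
  simpa using this

lemma HasCert.insert {N : ℕ} {A : ℕ → ℕ → Prop} {p q : List ℕ} (hp : p ≠ []) (hq : q ≠ [])
    (h : HasCert N A (p ++ q)) : HasCert (N + 1) A (p ++ N :: q) := by
  obtain ⟨E, F, i1, i2, i3, src, tgt, M, b, nd, h2, two, cyc, H1, h3, hA⟩ := h
  obtain ⟨p, x, rfl⟩ := List.eq_nil_or_concat p |>.resolve_left hp
  obtain ⟨y, q, rfl⟩ := List.exists_cons_of_ne_nil hq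
  rw [List.concat_eq_append, List.append_assoc] at h3
  obtain ⟨b1, e0, b2, rfl, g1, g2, g3, g4⟩ := links_split _ _ _ _ _ _ _ h3
  let src' : E ⊕ Bool → ℕ := Sum.elim src (fun c => if c then x else N)
  let tgt' : E ⊕ Bool → ℕ := Sum.elim tgt (fun c => if c then N else y)
  let M' : F ⊕ Unit → E ⊕ Bool → ZMod 2 :=
    Sum.elim (fun f => Sum.elim (M f) (fun _ => 0))
      (fun _ => Sum.elim (fun e => if e = e0 then 1 else 0) (fun _ => 1))
  have hx : x < N := g2 ▸ (h2 e0).1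
  have hy : y < N := g3 ▸ (h2 e0).2
  have nd' : b1.Nodup ∧ b2.Nodup ∧ e0 ∉ b1 ∧ e0 ∉ b2 ∧ ∀ e ∈ b1, e ∉ b2 := by
    rw [List.nodup_append] at nd
    obtain ⟨n1, n2, n3⟩ := nd
    rw [List.nodup_cons] at n2
    exact ⟨n1, n2.2, fun h => n3 _ h _ (by simp) rfl, n2.1,
      fun e he he' => n3 _ he _ (List.mem_cons_of_mem _ he') rfl⟩
  obtain ⟨n1, n2, n3, n4, n5⟩ := nd'
  refine ⟨E ⊕ Bool, F ⊕ Unit, inferInstance, inferInstance, inferInstance, src', tgt', M',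
    b1.map Sum.inl ++ Sum.inr true :: Sum.inr false :: b2.map Sum.inl, ?_, ?_, ?_, ?_, ?_, ?_, ?_⟩
  · rw [List.nodup_append]
    refine ⟨n1.map Sum.inl_injective, ?_, ?_⟩
    · simp [n2.map Sum.inl_injective]
    · simp only [List.mem_map, List.mem_cons]
      rintro a ⟨e, he, rfl⟩ c (rfl | rfl | ⟨e', he', rfl⟩) <;> simp
      rintro rfl
      exact n5 _ he he'
  · rintro (e | c)
    · exact ⟨(h2 e).1.trans (Nat.lt_succ_self _), (h2 e).2.trans (Nat.lt_succ_self _)⟩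
    · cases c <;> simp [src', tgt'] <;> omega
  · rintro (e | c)
    · have := two e
      simp only [Fintype.sum_sum_type, M', Sum.elim_inl, Sum.elim_inr]
      by_cases hee : e = e0
      · subst hee
        simp [n3, n4] at this ⊢
        convert this
        congr
      · simp [hee] at this ⊢
        exact this
    · simp only [Fintype.sum_sum_type, M', Sum.elim_inl, Sum.elim_inr]
      cases c <;> simp
  · rintro (f | u) h
    · simp only [Fintype.sum_sum_type, M', src', tgt', Sum.elim_inl, Sum.elim_inr]
      have := cyc f h
      simp [this]
    · simp only [Fintype.sum_sum_type, M', src', tgt', Sum.elim_inl, Sum.elim_inr]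
      simp [g2, g3]
      linear_combination (h x + h y + h N) * z2_two
  · intro z hz
    have hz1 := hz (fun v => if v = N then 1 else 0)
    have hc : z (Sum.inr false) = z (Sum.inr true) := by
      simp only [Fintype.sum_sum_type, src', tgt', Sum.elim_inl, Sum.elim_inr] at hz1
      rw [Finset.sum_eq_zero] at hz1
      · simp [hx.ne, hy.ne] at hz1
        exact (CharTwo.add_eq_zero.mp hz1).symm
      · intro e _
        simp [(h2 e).1.ne, (h2 e).2.ne]
    have hcyc : IsCyc src tgt (fun e => z (Sum.inl e) + z (Sum.inr true) * (if e = e0 then 1 else 0)) := by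
      intro h
      have := hz h
      simp only [Fintype.sum_sum_type, src', tgt', Sum.elim_inl, Sum.elim_inr] at this
      simp [hc] at this
      simp only [add_mul, Finset.sum_add_distrib]
      simp [g2, g3]
      simp only [mul_add, Finset.sum_add_distrib] at this ⊢
      linear_combination this - z (Sum.inr true) * h N * z2_two
    obtain ⟨a, ha⟩ := H1 _ hcyc
    refine ⟨Sum.elim a (fun _ => z (Sum.inr true)), ?_⟩
    rintro (e | c)
    · simp only [Fintype.sum_sum_type, M', Sum.elim_inl, Sum.elim_inr, ← ha]
      simp only [Finset.univ_unique, Finset.sum_singleton]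
      linear_combination (-(z (Sum.inr true) * (if e = e0 then 1 else 0))) * z2_two
    · simp only [Fintype.sum_sum_type, M', Sum.elim_inl, Sum.elim_inr]
      cases c <;> simp [hc]
  · rw [List.concat_eq_append, List.append_assoc]
    refine links_join src' tgt' x (N :: y :: q) _ ?_ p _ ?_
    · exact ⟨by simp [src'], by simp [tgt'], by simp [src'], by simp [tgt'],
        links_map src tgt src' tgt' Sum.inl (fun _ => rfl) (fun _ => rfl) _ _ g4⟩
    · exact links_map src tgt src' tgt' Sum.inl (fun _ => rfl) (fun _ => rfl) _ _ g1
  · intro u v huv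
    obtain ⟨e, he⟩ := hA u v huv
    exact ⟨Sum.inl e, he⟩

lemma HasCert.forget {N v : ℕ} {A : ℕ → ℕ → Prop} {p q : List ℕ} (hp : p ≠ []) (hq : q ≠ [])
    (h : HasCert N A (p ++ v :: q)) : HasCert N A (p ++ q) := by
  obtain ⟨E, F, i1, i2, i3, src, tgt, M, b, nd, h2, two, cyc, H1, h3, hA⟩ := h
  obtain ⟨p, x, rfl⟩ := List.eq_nil_or_concat p |>.resolve_left hp
  obtain ⟨y, q, rfl⟩ := List.exists_cons_of_ne_nil hq
  rw [List.concat_eq_append, List.append_assoc] at h3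
  obtain ⟨b1, e0, b2, rfl, g1, g2, g3, g4⟩ := links_split _ _ _ _ _ _ _ h3
  obtain ⟨b0, e1, b2, rfl, g5, g6, g7, g8⟩ := links_split src tgt v y q [] _ g4
  have hb0 : b0 = [] := by
    cases b0 with
    | nil => rfl
    | cons e b => simp [Links] at g5
  subst hb0
  simp only [List.nil_append] at *
  let src' : E ⊕ Unit → ℕ := Sum.elim src (fun _ => x)
  let tgt' : E ⊕ Unit → ℕ := Sum.elim tgt (fun _ => y)
  let M' : F ⊕ Unit → E ⊕ Unit → ZMod 2 :=
    Sum.elim (fun f => Sum.elim (M f) (fun _ => 0))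
      (fun _ => Sum.elim (fun e => (if e = e0 then 1 else 0) + (if e = e1 then 1 else 0))
        (fun _ => 1))
  have hx : x < N := g2 ▸ (h2 e0).1
  have hy : y < N := g7 ▸ (h2 e1).2
  have nd' : b1.Nodup ∧ b2.Nodup ∧ e0 ∉ b1 ∧ e0 ∉ b2 ∧ e1 ∉ b1 ∧ e1 ∉ b2 ∧ e0 ≠ e1 ∧
      ∀ e ∈ b1, e ∉ b2 := by
    rw [List.nodup_append] at nd
    obtain ⟨n1, n2, n3⟩ := nd
    rw [List.nodup_cons, List.nodup_cons] at n2
    exact ⟨n1, n2.2.2, fun h => n3 _ h _ (by simp) rfl,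
      fun h => n2.1 (List.mem_cons_of_mem _ h), fun h => n3 _ h _ (by simp) rfl, n2.2.1,
      fun h => n2.1 (by simp [h]),
      fun e he he' => n3 _ he _ (by simp [he']) rfl⟩
  obtain ⟨n1, n2, n3, n4, n3', n4', n01, n5⟩ := nd'
  refine ⟨E ⊕ Unit, F ⊕ Unit, inferInstance, inferInstance, inferInstance, src', tgt', M',
    b1.map Sum.inl ++ Sum.inr () :: b2.map Sum.inl, ?_, ?_, ?_, ?_, ?_, ?_, ?_⟩
  · rw [List.nodup_append]
    refine ⟨n1.map Sum.inl_injective, ?_, ?_⟩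
    · simp [n2.map Sum.inl_injective]
    · simp only [List.mem_map, List.mem_cons]
      rintro a ⟨e, he, rfl⟩ c (rfl | ⟨e', he', rfl⟩) <;> simp
      rintro rfl
      exact n5 _ he he'
  · rintro (e | c)
    · exact h2 e
    · exact ⟨hx, hy⟩
  · rintro (e | c)
    · have := two e
      simp only [Fintype.sum_sum_type, M', Sum.elim_inl, Sum.elim_inr]
      by_cases hee : e = e0
      · subst hee
        simp [n3, n4, n01] at this ⊢
        convert this
        congr
      · by_cases hee1 : e = e1
        · subst hee1
          simp [n3', n4', n01.symm] at this ⊢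
          convert this
          congr
        · simp [hee, hee1] at this ⊢
          exact this
    · simp only [Fintype.sum_sum_type, M', Sum.elim_inl, Sum.elim_inr]
      simp
  · rintro (f | u) h
    · simp only [Fintype.sum_sum_type, M', src', tgt', Sum.elim_inl, Sum.elim_inr]
      have := cyc f h
      simp [this]
    · simp only [Fintype.sum_sum_type, M', src', tgt', Sum.elim_inl, Sum.elim_inr]
      simp only [add_mul, Finset.sum_add_distrib]
      simp [g2, g3, g6, g7]
      linear_combination (h x + h y + h v) * z2_two
  · intro z hz
    have hcyc : IsCyc src tgt (fun e => z (Sum.inl e) +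
      z (Sum.inr ()) * ((if e = e0 then 1 else 0) + (if e = e1 then 1 else 0))) := by
      intro h
      have := hz h
      simp only [Fintype.sum_sum_type, src', tgt', Sum.elim_inl, Sum.elim_inr] at this
      simp at this
      simp only [add_mul, mul_add, Finset.sum_add_distrib] at this ⊢
      simp [g2, g3, g6, g7]
      linear_combination this + z (Sum.inr ()) * h v * z2_two
    obtain ⟨a, ha⟩ := H1 _ hcyc
    refine ⟨Sum.elim a (fun _ => z (Sum.inr ())), ?_⟩
    rintro (e | c)
    · simp only [Fintype.sum_sum_type, M', Sum.elim_inl, Sum.elim_inr, ← ha]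
      simp only [Finset.univ_unique, Finset.sum_singleton]
      linear_combination (-(z (Sum.inr ()) *
        ((if e = e0 then 1 else 0) + (if e = e1 then 1 else 0)))) * z2_two
    · simp only [Fintype.sum_sum_type, M', Sum.elim_inl, Sum.elim_inr]
      simp
  · rw [List.concat_eq_append, List.append_assoc]
    refine links_join src' tgt' x (y :: q) _ ?_ p _ ?_
    · exact ⟨by simp [src'], by simp [tgt'],
        links_map src tgt src' tgt' Sum.inl (fun _ => rfl) (fun _ => rfl) _ _ g8⟩
    · exact links_map src tgt src' tgt' Sum.inl (fun _ => rfl) (fun _ => rfl) _ _ g1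
  · intro u v huv
    obtain ⟨e, he⟩ := hA u v huv
    exact ⟨Sum.inl e, he⟩

end RR
namespace RR

/-- the adjacencies certified by the planar disc -/
def CA (n : ℕ) (G : SimpleGraph ℕ) (x y : ℕ) : Prop :=
  G.Adj x y ∨ (x = 1 ∧ 2 ≤ y ∧ y < n + 2) ∨ (y = 1 ∧ 2 ≤ x ∧ x < n + 2)

/-- relations between root colorings and boundary words realized by planar discs -/
def Good (n k : ℕ) (S : (Fin n → Fin 3) → List (Fin 3) → Prop) : Prop :=
  ∃ (N : ℕ) (G : SimpleGraph ℕ) (L : List ℕ), L.length = k ∧ L.Nodup ∧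
    (∀ x ∈ L, 2 ≤ x ∧ x < N) ∧ n + 2 ≤ N ∧ (∀ x y, G.Adj x y → 2 ≤ x ∧ x < N) ∧
    HasCert N (CA n G) (0 :: (L ++ [1])) ∧
    ∀ f w, S f w ↔ ∃ c : ℕ → Fin 3, IsProperColoring G c ∧
      (∀ i : Fin n, c (i + 2) = f i) ∧ L.map c = w

lemma Good.congr {n k : ℕ} {S S' : (Fin n → Fin 3) → List (Fin 3) → Prop} (h : Good n k S)
    (hS : ∀ f w, S' f w ↔ S f w) : Good n k S' := by
  obtain ⟨N, G, L, h1, h2, h3, h4, h5, h6, h7⟩ := h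
  exact ⟨N, G, L, h1, h2, h3, h4, h5, h6, fun f w => (hS f w).trans (h7 f w)⟩

lemma cert_start (n : ℕ) : HasCert (n + 2) (CA n ⊥) (0 :: (List.range' 2 n ++ [1])) := by
  induction n with
  | zero =>
    refine HasCert.start.mono ?_
    intro x y h
    rcases h with h | h | h
    · simp at h
    · omega
    · omega
  | succ n ih =>
    have h1 : HasCert (n + 2) (CA n ⊥) ((0 :: List.range' 2 n) ++ [1]) := ih
    have h2 := HasCert.insert (by simp) (by simp) h1
    have h3 := HasCert.adj h2
    have e : (0 :: (List.range' 2 (n + 1) ++ [1]))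
        = (0 :: List.range' 2 n) ++ (n + 2) :: 1 :: [] := by
      rw [List.range'_concat]
      simp [add_comm]
    rw [e]
    refine h3.mono ?_
    intro x y h
    simp only [CA, SimpleGraph.bot_adj, false_or] at h ⊢
    omega

lemma good_start (n : ℕ) : Good n n (fun f w => w = List.ofFn f) := by
  refine ⟨n + 2, ⊥, List.range' 2 n, by simp, List.nodup_range', ?_, le_rfl, by simp,
    cert_start n, ?_⟩
  · intro x hx
    rw [List.mem_range'_1] at hx
    omega
  · intro f w
    have key : ∀ c : ℕ → Fin 3, (∀ i : Fin n, c (i + 2) = f i) →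
        (List.range' 2 n).map c = List.ofFn f := by
      intro c hc
      apply List.ext_getElem
      · simp
      · intro i h1 h2
        have hi : i < n := by simpa using h1
        have := hc ⟨i, hi⟩
        simp [← this, add_comm]
    constructor
    · rintro rfl
      obtain ⟨c, hc⟩ : ∃ c : ℕ → Fin 3, ∀ i : Fin n, c (i + 2) = f i :=
        ⟨fun v => if h : v - 2 < n then f ⟨v - 2, h⟩ else 0, by intro i; simp⟩
      exact ⟨c, by intro x y h; simp at h, hc, (key c hc)⟩
    · rintro ⟨c, -, hc, rfl⟩
      exact key c hc

/-- elementary operations on boundary words -/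
inductive Op
  | ins (i : ℕ)
  | del (i : ℕ)
  | neq (i : ℕ)

/-- the results of an operation -/
def step : Op → List (Fin 3) → List (List (Fin 3))
  | .ins i, w => [w.take i ++ 0 :: w.drop i, w.take i ++ 1 :: w.drop i, w.take i ++ 2 :: w.drop i]
  | .del i, w => [w.take i ++ w.drop (i + 1)]
  | .neq i, w => if w[i]? = w[i + 1]? then [] else [w]

/-- applicability to words of length `k` -/
def Op.ok : Op → ℕ → Bool
  | .ins i, k => decide (i ≤ k)
  | .del i, k => decide (i < k)
  | .neq i, k => decide (i + 1 < k)

/-- new length -/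
def Op.len : Op → ℕ → ℕ
  | .ins _, k => k + 1
  | .del _, k => k - 1
  | .neq _, k => k

/-- shift to the right -/
def Op.shift (m : ℕ) : Op → Op
  | .ins i => .ins (m + i)
  | .del i => .del (m + i)
  | .neq i => .neq (m + i)

lemma good_ins {n k : ℕ} {S : (Fin n → Fin 3) → List (Fin 3) → Prop} (h : Good n k S) (i : ℕ)
    (hi : i ≤ k) : Good n (k + 1) (fun f w' => ∃ w, S f w ∧ w' ∈ step (.ins i) w) := by
  obtain ⟨N, G, L, h1, h2, h3, h4, h5, h6, h7⟩ := h
  have hN : N ∉ L := fun h => lt_irrefl _ (h3 N h).2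
  have hmem : ∀ x, x ∈ L.take i ++ N :: L.drop i ↔ x = N ∨ x ∈ L := by
    intro x
    conv_rhs => rw [← List.take_append_drop i L]
    simp only [List.mem_append, List.mem_cons]
    tauto
  have hperm : (L.take i ++ N :: L.drop i).Perm (N :: L) := by
    conv_rhs => rw [← List.take_append_drop i L]
    exact List.perm_middle
  refine ⟨N + 1, G, L.take i ++ N :: L.drop i, ?_, ?_, ?_, by omega, ?_, ?_, ?_⟩
  · rw [hperm.length_eq]; simp [h1]
  · rw [hperm.nodup_iff]
    exact List.nodup_cons.mpr ⟨hN, h2⟩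
  · intro x hx
    rcases (hmem x).mp hx with rfl | hx
    · omega
    · have := h3 x hx; omega
  · intro x y hxy
    have := h5 x y hxy; omega
  · have e : (0 :: (L ++ [1])) = (0 :: L.take i) ++ (L.drop i ++ [1]) := by
      simp [← List.append_assoc]
    rw [e] at h6
    have := HasCert.insert (by simp) (by simp) h6
    simpa using this
  · intro f w'
    constructor
    · rintro ⟨w, hw, hw'⟩
      obtain ⟨c, hc, hr, rfl⟩ := (h7 f w).mp hw
      have : ∃ col, w' = (L.map c).take i ++ col :: (L.map c).drop i := by
        simp only [step, List.mem_cons, List.not_mem_nil, or_false] at hw'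
        rcases hw' with h | h | h <;> exact ⟨_, h⟩
      obtain ⟨col, rfl⟩ := this
      have hc' : ∀ x, x < N → Function.update c N col x = c x :=
        fun x hx => Function.update_of_ne hx.ne _ _
      refine ⟨Function.update c N col, ?_, ?_, ?_⟩
      · intro x y hxy
        rw [hc' x (h5 x y hxy).2, hc' y (h5 y x hxy.symm).2]
        exact hc hxy
      · intro j
        rw [hc' _ (by omega)]
        exact hr j
      · rw [List.map_append, List.map_cons, Function.update_self, ← List.map_take,
          ← List.map_drop]
        congr 1
        · exact List.map_congr_left (fun x hx => hc' x (h3 x (List.mem_of_mem_take hx)).2)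
        · congr 1
          exact List.map_congr_left (fun x hx => hc' x (h3 x (List.mem_of_mem_drop hx)).2)
    · rintro ⟨c, hc, hr, rfl⟩
      refine ⟨L.map c, (h7 _ _).mpr ⟨c, hc, hr, rfl⟩, ?_⟩
      rw [List.map_append, List.map_cons, List.map_take, List.map_drop]
      have : ∀ a : Fin 3, a = 0 ∨ a = 1 ∨ a = 2 := by decide
      simp only [step, List.mem_cons, List.not_mem_nil, or_false]
      rcases this (c N) with h | h | h <;> simp [h]

lemma good_del {n k : ℕ} {S : (Fin n → Fin 3) → List (Fin 3) → Prop} (h : Good n k S) (i : ℕ)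
    (hi : i < k) : Good n (k - 1) (fun f w' => ∃ w, S f w ∧ w' ∈ step (.del i) w) := by
  obtain ⟨N, G, L, h1, h2, h3, h4, h5, h6, h7⟩ := h
  have hsub : (L.take i ++ L.drop (i + 1)).Sublist L := by
    conv_rhs => rw [← List.take_append_drop i L]
    exact List.Sublist.append (List.Sublist.refl _)
      (List.drop_sublist_drop_left _ (Nat.le_succ i))
  refine ⟨N, G, L.take i ++ L.drop (i + 1), ?_, h2.sublist hsub,
    fun x hx => h3 x (hsub.subset hx), h4, h5, ?_, ?_⟩
  · simp only [List.length_append, List.length_take, List.length_drop]; omega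
  · have e : (0 :: (L ++ [1])) = (0 :: L.take i) ++ L[i]'(by omega) :: (L.drop (i + 1) ++ [1]) := by
      rw [← List.cons_append (a := L[i]'(by omega)), ← List.drop_eq_getElem_cons]
      simp [← List.append_assoc]
    rw [e] at h6
    have := HasCert.forget (by simp) (by simp) h6
    simpa using this
  · intro f w'
    simp only [step, List.mem_singleton]
    constructor
    · rintro ⟨w, hw, rfl⟩
      obtain ⟨c, hc, hr, rfl⟩ := (h7 f w).mp hw
      exact ⟨c, hc, hr, by simp⟩
    · rintro ⟨c, hc, hr, rfl⟩
      exact ⟨L.map c, (h7 _ _).mpr ⟨c, hc, hr, rfl⟩, by simp⟩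

lemma good_neq {n k : ℕ} {S : (Fin n → Fin 3) → List (Fin 3) → Prop} (h : Good n k S) (i : ℕ)
    (hi : i + 1 < k) : Good n k (fun f w' => ∃ w, S f w ∧ w' ∈ step (.neq i) w) := by
  obtain ⟨N, G, L, h1, h2, h3, h4, h5, h6, h7⟩ := h
  subst h1
  set a := L[i]'(by omega) with ha
  set b := L[i + 1]'(by omega) with hb
  have hab : a ≠ b := by
    intro h
    have := (List.Nodup.getElem_inj_iff h2).mp h
    omega
  have hadj : ∀ x y, (G ⊔ SimpleGraph.edge a b).Adj x y ↔
      G.Adj x y ∨ (x = a ∧ y = b) ∨ (x = b ∧ y = a) := by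
    intro x y
    rw [SimpleGraph.sup_adj, SimpleGraph.edge_adj]
    constructor
    · rintro (h | ⟨⟨rfl, rfl⟩ | ⟨rfl, rfl⟩, -⟩) <;> simp_all
    · rintro (h | ⟨rfl, rfl⟩ | ⟨rfl, rfl⟩)
      · exact Or.inl h
      · exact Or.inr ⟨Or.inl ⟨rfl, rfl⟩, hab⟩
      · exact Or.inr ⟨Or.inr ⟨rfl, rfl⟩, hab.symm⟩
  have haL : a ∈ L := List.getElem_mem _
  have hbL : b ∈ L := List.getElem_mem _
  refine ⟨N, G ⊔ SimpleGraph.edge a b, L, rfl, h2, h3, h4, ?_, ?_, ?_⟩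
  · intro x y hxy
    rcases (hadj x y).mp hxy with h | ⟨rfl, rfl⟩ | ⟨rfl, rfl⟩
    · exact h5 x y h
    · exact h3 _ haL
    · exact h3 _ hbL
  · have e : (0 :: (L ++ [1])) = (0 :: L.take i) ++ a :: b :: (L.drop (i + 2) ++ [1]) := by
      rw [← List.cons_append (a := b), hb, ← List.drop_eq_getElem_cons,
        ← List.cons_append (a := a), ha, ← List.drop_eq_getElem_cons]
      simp [← List.append_assoc]
    rw [e] at h6 ⊢
    refine h6.adj.mono ?_
    intro x y h
    simp only [CA, hadj] at h ⊢
    tauto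
  · intro f w'
    have key : ∀ c : ℕ → Fin 3, w' ∈ step (.neq i) (L.map c) ↔ c a ≠ c b ∧ w' = L.map c := by
      intro c
      have e1 : (L.map c)[i]? = some (c a) := by
        rw [List.getElem?_map, List.getElem?_eq_getElem (by omega)]; rfl
      have e2 : (L.map c)[i + 1]? = some (c b) := by
        rw [List.getElem?_map, List.getElem?_eq_getElem (by omega)]; rfl
      simp only [step, e1, e2, Option.some.injEq]
      split_ifs with h <;> simp [h]
    constructor
    · rintro ⟨w, hw, hw'⟩
      obtain ⟨c, hc, hr, rfl⟩ := (h7 f w).mp hw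
      obtain ⟨hne, rfl⟩ := (key c).mp hw'
      refine ⟨c, ?_, hr, rfl⟩
      intro x y hxy
      rcases (hadj x y).mp hxy with h | ⟨rfl, rfl⟩ | ⟨rfl, rfl⟩
      · exact hc h
      · exact hne
      · exact hne.symm
    · rintro ⟨c, hc, hr, rfl⟩
      refine ⟨L.map c, (h7 _ _).mpr ⟨c, ?_, hr, rfl⟩, (key c).mpr ⟨?_, rfl⟩⟩
      · intro x y hxy
        exact hc ((hadj x y).mpr (Or.inl hxy))
      · exact hc ((hadj a b).mpr (Or.inr (Or.inl ⟨rfl, rfl⟩)))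

lemma good_step {n k : ℕ} {S : (Fin n → Fin 3) → List (Fin 3) → Prop} (h : Good n k S) (o : Op)
    (ho : o.ok k = true) : Good n (o.len k) (fun f w' => ∃ w, S f w ∧ w' ∈ step o w) := by
  cases o with
  | ins i => exact good_ins h i (by simpa [Op.ok] using ho)
  | del i => exact good_del h i (by simpa [Op.ok] using ho)
  | neq i => exact good_neq h i (by simpa [Op.ok] using ho)

/-- run a program -/
def run : List Op → List (Fin 3) → List (List (Fin 3))
  | [], w => [w]
  | o :: os, w => (step o w).flatMap (run os)

/-- validity of a program -/
def okAll : List Op → ℕ → Bool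
  | [], _ => true
  | o :: os, k => o.ok k && okAll os (o.len k)

/-- final length -/
def lenAll : List Op → ℕ → ℕ
  | [], k => k
  | o :: os, k => lenAll os (o.len k)

lemma good_run {n : ℕ} (P : List Op) : ∀ {k : ℕ} {S : (Fin n → Fin 3) → List (Fin 3) → Prop},
    Good n k S → okAll P k = true →
    Good n (lenAll P k) (fun f w' => ∃ w, S f w ∧ w' ∈ run P w) := by
  induction P with
  | nil =>
    intro k S h _
    exact h.congr (by simp [run])
  | cons o os ih =>
    intro k S h hok
    simp only [okAll, Bool.and_eq_true] at hok
    refine (ih (good_step h o hok.1) hok.2).congr ?_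
    intro f w
    simp only [run, List.mem_flatMap]
    constructor
    · rintro ⟨w1, h1, w2, h2, h3⟩
      exact ⟨w2, ⟨w1, h1, h2⟩, h3⟩
    · rintro ⟨w2, ⟨w1, h1, h2⟩, h3⟩
      exact ⟨w1, h1, w2, h2, h3⟩

lemma step_shift (u v t : List (Fin 3)) (o : Op) (ho : o.ok v.length = true) :
    step (o.shift u.length) (u ++ v ++ t) = (step o v).map (fun v' => u ++ v' ++ t) := by
  cases o with
  | ins i =>
    have hi : i ≤ v.length := by simpa [Op.ok] using ho
    have e1 : (u ++ v ++ t).take (u.length + i) = u ++ v.take i := by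
      rw [List.append_assoc, List.take_length_add_append, List.take_append_of_le_length hi]
    have e2 : (u ++ v ++ t).drop (u.length + i) = v.drop i ++ t := by
      rw [List.append_assoc, List.drop_length_add_append, List.drop_append_of_le_length hi]
    simp [step, Op.shift, e1, e2, ← List.append_assoc] <;> simp [List.append_assoc, e1, e2]
  | del i =>
    have hi : i < v.length := by simpa [Op.ok] using ho
    have e1 : (u ++ v ++ t).take (u.length + i) = u ++ v.take i := by
      rw [List.append_assoc, List.take_length_add_append, List.take_append_of_le_length hi.le]
    have e2 : (u ++ v ++ t).drop (u.length + i + 1) = v.drop (i + 1) ++ t := by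
      rw [List.append_assoc, add_assoc, List.drop_length_add_append,
        List.drop_append_of_le_length hi]
    simp only [step, Op.shift, e1, e2, List.map_cons, List.map_nil]
    simp only [List.append_assoc]
  | neq i =>
    have hi : i + 1 < v.length := by simpa [Op.ok] using ho
    have e1 : (u ++ v ++ t)[u.length + i]? = v[i]? := by
      rw [List.append_assoc, List.getElem?_append_right (by omega),
        List.getElem?_append_left (by omega)]
      congr 1; omega
    have e2 : (u ++ v ++ t)[u.length + i + 1]? = v[i + 1]? := by
      rw [List.append_assoc, List.getElem?_append_right (by omega),
        List.getElem?_append_left (by omega)]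
      congr 1; omega
    simp only [step, Op.shift, e1, e2]
    split_ifs <;> simp

lemma step_len (v v' : List (Fin 3)) (o : Op) (ho : o.ok v.length = true) (h : v' ∈ step o v) :
    v'.length = o.len v.length := by
  cases o with
  | ins i =>
    simp only [Op.ok, decide_eq_true_eq] at ho
    simp only [step, List.mem_cons, List.not_mem_nil, or_false] at h
    rcases h with rfl | rfl | rfl <;> simp [Op.len] <;> omega
  | del i =>
    simp only [Op.ok, decide_eq_true_eq] at ho
    simp only [step, List.mem_cons, List.not_mem_nil, or_false] at h
    subst h
    simp [Op.len]; omega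
  | neq i =>
    simp only [step] at h
    split_ifs at h
    · simp at h
    · simp only [List.mem_singleton] at h
      subst h; rfl

lemma runs_shift (u t : List (Fin 3)) (P : List Op) : ∀ (v : List (Fin 3)),
    okAll P v.length = true → ∀ w, w ∈ run (P.map (Op.shift u.length)) (u ++ v ++ t) ↔
      ∃ v' ∈ run P v, w = u ++ v' ++ t := by
  induction P with
  | nil => intro v _ w; simp [run]
  | cons o os ih =>
    intro v hok w
    simp only [okAll, Bool.and_eq_true] at hok
    simp only [List.map_cons, run, List.mem_flatMap, step_shift u v t o hok.1, List.mem_map]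
    constructor
    · rintro ⟨_, ⟨v1, hv1, rfl⟩, hw⟩
      obtain ⟨v', hv', rfl⟩ := (ih v1 (by rw [step_len v v1 o hok.1 hv1]; exact hok.2) w).mp hw
      exact ⟨v', ⟨v1, hv1, hv'⟩, rfl⟩
    · rintro ⟨v', ⟨v1, hv1, hv'⟩, rfl⟩
      exact ⟨_, ⟨v1, hv1, rfl⟩,
        (ih v1 (by rw [step_len v v1 o hok.1 hv1]; exact hok.2) _).mpr ⟨v', hv', rfl⟩⟩

lemma ok_shift (m r : ℕ) (P : List Op) : ∀ k, okAll P k = true →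
    okAll (P.map (Op.shift m)) (m + k + r) = true ∧
    lenAll (P.map (Op.shift m)) (m + k + r) = m + lenAll P k + r := by
  induction P with
  | nil => intro k _; simp [okAll, lenAll]
  | cons o os ih =>
    intro k hok
    simp only [okAll, Bool.and_eq_true] at hok
    have h1 : (o.shift m).len (m + k + r) = m + o.len k + r := by
      cases o <;> simp [Op.shift, Op.len, Op.ok] at hok ⊢ <;> omega
    have h2 : (o.shift m).ok (m + k + r) = true := by
      cases o <;> simp [Op.shift, Op.ok] at hok ⊢ <;> omega
    obtain ⟨h3, h4⟩ := ih _ hok.2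
    simp only [List.map_cons, okAll, lenAll, h1, h2, h3, h4, Bool.and_self, and_self]

/-- insert with inequalities to both neighbours -/
def insN (i : ℕ) : List Op := [.ins i, .neq (i - 1), .neq i]

/-- gadget `[x, y] ↦ [x, -(x + y), y]` -/
def aed : List Op :=
  insN 1 ++ insN 1 ++ insN 2 ++ [.del 3] ++ insN 3 ++ [.del 2] ++ insN 2 ++ [.del 3] ++ insN 2 ++
    [.del 1, .neq 2, .del 2]

/-- the crossover -/
def swapProg : List Op :=
  aed ++ aed ++ [.del 0] ++ aed.map (Op.shift 1) ++ [.del 3, .del 1]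

lemma swap_ok : okAll swapProg 2 = true ∧ lenAll swapProg 2 = 2 := by decide

lemma swap_run : ∀ a b : Fin 3, (run swapProg [a, b]).dedup = [[b, a]] := by decide +kernel

lemma good_swap {n k : ℕ} {S : (Fin n → Fin 3) → List (Fin 3) → Prop} (h : Good n k S) (m : ℕ)
    (hm : m + 1 < k) : Good n k (fun f w' => ∃ u a b t, u.length = m ∧
      w' = u ++ b :: a :: t ∧ S f (u ++ a :: b :: t)) := by
  obtain ⟨r, rfl⟩ : ∃ r, k = m + 2 + r := ⟨k - (m + 2), by omega⟩
  obtain ⟨h1, h2⟩ := ok_shift m r swapProg 2 swap_ok.1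
  have := good_run _ h h1
  rw [h2, swap_ok.2] at this
  refine this.congr ?_
  have hmem : ∀ a b w, w ∈ run swapProg [a, b] ↔ w = [b, a] := by
    intro a b w
    rw [← List.mem_dedup, swap_run, List.mem_singleton]
  intro f w'
  constructor
  · rintro ⟨u, a, b, t, rfl, rfl, hS⟩
    refine ⟨_, hS, ?_⟩
    have := (runs_shift u t swapProg [a, b] swap_ok.1 (u ++ b :: a :: t)).mpr
      ⟨[b, a], (hmem _ _ _).mpr rfl, by simp⟩
    simpa using this
  · rintro ⟨w, hS, hw⟩
    have hlen : w.length = m + 2 + r := by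
      obtain ⟨N, G, L, g1, -, -, -, -, -, g7⟩ := h
      obtain ⟨c, -, -, rfl⟩ := (g7 f w).mp hS
      simpa using g1
    obtain ⟨u, a, b, t, rfl, rfl⟩ : ∃ u a b t, u.length = m ∧ w = u ++ a :: b :: t := by
      refine ⟨w.take m, w[m]'(by omega), w[m + 1]'(by omega), w.drop (m + 2), ?_, ?_⟩
      · rw [List.length_take]; omega
      · rw [← List.drop_eq_getElem_cons, ← List.drop_eq_getElem_cons, List.take_append_drop]
    have e : u ++ a :: b :: t = u ++ [a, b] ++ t := by simp
    rw [e] at hw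
    obtain ⟨v', hv', rfl⟩ := (runs_shift u t swapProg [a, b] swap_ok.1 w').mp hw
    rw [(hmem _ _ _).mp hv']
    exact ⟨u, a, b, t, rfl, by simp, hS⟩

end RR
namespace RR

/-- boundary words carrying the values of named variables -/
def GoodE (n : ℕ) (p : List ℕ) (Q : (ℕ → Fin 3) → Prop) : Prop :=
  Good n p.length (fun f w => ∃ env : ℕ → Fin 3,
    (∀ i : Fin n, env i = f i) ∧ Q env ∧ w = p.map env)

lemma GoodE.swap {n a b : ℕ} {p₁ p₂ : List ℕ} {Q : (ℕ → Fin 3) → Prop}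
    (h : GoodE n (p₁ ++ a :: b :: p₂) Q) : GoodE n (p₁ ++ b :: a :: p₂) Q := by
  have h1 := good_swap h p₁.length (by simp)
  unfold GoodE
  have e : (p₁ ++ b :: a :: p₂).length = (p₁ ++ a :: b :: p₂).length := by simp
  rw [e]
  refine h1.congr ?_
  intro f w
  constructor
  · rintro ⟨env, h1, h2, rfl⟩
    exact ⟨p₁.map env, env a, env b, p₂.map env, by simp, by simp, env, h1, h2, by simp⟩
  · rintro ⟨u, x, y, t, hu, rfl, env, h1, h2, h3⟩
    refine ⟨env, h1, h2, ?_⟩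
    rw [List.map_append] at h3
    obtain ⟨h4, h5⟩ := List.append_inj h3 (by simpa using hu)
    simp only [List.map_cons, List.cons.injEq] at h5
    obtain ⟨h6, h7, h8⟩ := h5
    simp [h4, h6, h7, h8]

lemma GoodE.perm_aux {n : ℕ} {Q : (ℕ → Fin 3) → Prop} {l l' : List ℕ} (hp : l.Perm l') :
    ∀ p₁ : List ℕ, GoodE n (p₁ ++ l) Q → GoodE n (p₁ ++ l') Q := by
  induction hp with
  | nil => exact fun _ h => h
  | cons x _ ih =>
    intro p₁ h
    have := ih (p₁ ++ [x]) (by simpa using h)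
    simpa using this
  | swap x y l => exact fun _ h => h.swap
  | trans _ _ ih1 ih2 => exact fun p₁ h => ih2 p₁ (ih1 p₁ h)

lemma GoodE.perm {n : ℕ} {Q : (ℕ → Fin 3) → Prop} {l l' : List ℕ} (h : GoodE n l Q)
    (hp : l.Perm l') : GoodE n l' Q := GoodE.perm_aux hp [] h

lemma GoodE.neq_head {n a b : ℕ} {p : List ℕ} {Q : (ℕ → Fin 3) → Prop}
    (h : GoodE n (a :: b :: p) Q) :
    GoodE n (a :: b :: p) (fun env => Q env ∧ env a ≠ env b) := by
  refine (good_neq h 0 (by simp)).congr ?_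
  intro f w
  constructor
  · rintro ⟨env, h1, ⟨h2, h3⟩, rfl⟩
    exact ⟨_, ⟨env, h1, h2, rfl⟩, by simp [step, h3]⟩
  · rintro ⟨_, ⟨env, h1, h2, rfl⟩, hw⟩
    by_cases h3 : env a = env b
    · simp [step, h3] at hw
    · simp [step, h3] at hw
      exact ⟨env, h1, ⟨h2, h3⟩, by simpa using hw⟩

lemma GoodE.neq {n a b : ℕ} {p : List ℕ} {Q : (ℕ → Fin 3) → Prop}
    (h : GoodE n p Q) (ha : a ∈ p) (hb : b ∈ p) (hab : a ≠ b) :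
    GoodE n p (fun env => Q env ∧ env a ≠ env b) := by
  have h1 := List.perm_cons_erase ha
  have h2 : b ∈ p.erase a := (List.mem_erase_of_ne hab.symm).mpr hb
  have h3 := h1.trans ((List.perm_cons_erase h2).cons a)
  exact (h.perm h3).neq_head.perm h3.symm

lemma GoodE.congr {n : ℕ} {p : List ℕ} {Q Q' : (ℕ → Fin 3) → Prop}
    (h : GoodE n p Q) (hQ : ∀ env, Q' env ↔ Q env) : GoodE n p Q' := by
  have : Q' = Q := funext fun e => propext (hQ e)
  rwa [this]

lemma goodE_start (n k : ℕ) : GoodE n (List.range (n + k)) (fun _ => True) := by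
  induction k with
  | zero =>
    unfold GoodE
    have := good_start n
    rw [List.length_range]
    refine this.congr ?_
    intro f w
    have key : ∀ env : ℕ → Fin 3, (∀ i : Fin n, env i = f i) →
        (List.range n).map env = List.ofFn f := by
      intro env he
      apply List.ext_getElem
      · simp
      · intro i h1 h2
        have hi : i < n := by simpa using h1
        simpa using he ⟨i, hi⟩
    constructor
    · rintro ⟨env, h1, -, rfl⟩
      exact key env h1
    · rintro rfl
      obtain ⟨env, he⟩ : ∃ env : ℕ → Fin 3, ∀ i : Fin n, env i = f i :=
        ⟨fun v => if h : v < n then f ⟨v, h⟩ else 0, by intro i; simp⟩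
      exact ⟨env, he, trivial, (key env he).symm⟩
  | succ k ih =>
    have h := good_ins ih (n + k) (by simp)
    unfold GoodE
    have e : (List.range (n + (k + 1))).length = (List.range (n + k)).length + 1 := by simp; omega
    rw [e]
    refine h.congr ?_
    intro f w
    have e2 : List.range (n + (k + 1)) = List.range (n + k) ++ [n + k] := by
      rw [← add_assoc, List.range_succ]
    rw [e2]
    have hst : ∀ v : List (Fin 3), v.length = n + k →
        (w ∈ step (.ins (n + k)) v ↔ ∃ col, w = v ++ [col]) := by
      intro v hv
      have t1 : v.take (n + k) = v := List.take_of_length_le hv.le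
      have t2 : v.drop (n + k) = [] := List.drop_of_length_le hv.le
      simp only [step, t1, t2, List.mem_cons, List.not_mem_nil, or_false]
      constructor
      · rintro (h | h | h) <;> exact ⟨_, h⟩
      · rintro ⟨col, rfl⟩
        have : ∀ a : Fin 3, a = 0 ∨ a = 1 ∨ a = 2 := by decide
        rcases this col with h | h | h <;> simp [h]
    constructor
    · rintro ⟨env, h1, -, rfl⟩
      refine ⟨_, ⟨env, h1, trivial, rfl⟩, (hst _ (by simp)).mpr ⟨env (n + k), by simp⟩⟩
    · rintro ⟨_, ⟨env, h1, -, rfl⟩, hw⟩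
      obtain ⟨col, rfl⟩ := (hst _ (by simp)).mp hw
      refine ⟨Function.update env (n + k) col, ?_, trivial, ?_⟩
      · intro i
        rw [Function.update_of_ne (by omega)]
        exact h1 i
      · rw [List.map_append, List.map_singleton, Function.update_self]
        congr 1
        apply List.map_congr_left
        intro x hx
        rw [List.mem_range] at hx
        rw [Function.update_of_ne (by omega)]

lemma goodE_graph (n k : ℕ) (E : List (ℕ × ℕ))
    (hE : ∀ e ∈ E, e.1 < n + k ∧ e.2 < n + k ∧ e.1 ≠ e.2) :
    GoodE n (List.range (n + k)) (fun env => ∀ e ∈ E, env e.1 ≠ env e.2) := by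
  induction E with
  | nil => exact (goodE_start n k).congr (by simp)
  | cons e E ih =>
    have he := hE e (by simp)
    have h := (ih (fun x hx => hE x (by simp [hx]))).neq (a := e.1) (b := e.2)
      (by simpa using he.1) (by simpa using he.2.1) he.2.2
    refine h.congr ?_
    intro env
    simp only [List.mem_cons, forall_eq_or_imp]
    tauto

end RR
namespace RR

/-- primitive positive definability from disequality -/
def PP {V : Type} (Q : (V → Fin 3) → Prop) : Prop :=
  ∃ (W : Type) (_ : Finite W) (R : V ⊕ W → V ⊕ W → Prop), (∀ x, ¬ R x x) ∧
    ∀ f, Q f ↔ ∃ g : W → Fin 3, ∀ x y, R x y → Sum.elim f g x ≠ Sum.elim f g y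

lemma PP.congr {V : Type} {Q Q' : (V → Fin 3) → Prop} (h : PP Q) (hQ : ∀ f, Q' f ↔ Q f) :
    PP Q' := by
  have : Q' = Q := funext fun e => propext (hQ e)
  rwa [this]

lemma PP.neq {V : Type} {x y : V} (h : x ≠ y) : PP (fun f : V → Fin 3 => f x ≠ f y) := by
  refine ⟨Empty, inferInstance, fun a b => a = Sum.inl x ∧ b = Sum.inl y, ?_, ?_⟩
  · rintro _ ⟨rfl, h2⟩
    exact h (Sum.inl_injective h2)
  · intro f
    constructor
    · intro hf
      refine ⟨Empty.elim, ?_⟩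
      rintro _ _ ⟨rfl, rfl⟩
      exact hf
    · rintro ⟨g, hg⟩
      exact hg _ _ ⟨rfl, rfl⟩

lemma PP.all {V ι : Type} [Finite ι] {Q : ι → (V → Fin 3) → Prop} (h : ∀ i, PP (Q i)) :
    PP (fun f => ∀ i, Q i f) := by
  choose W hW R hR hQ using h
  refine ⟨Σ i, W i, inferInstance, fun x y => ∃ i a b, R i a b ∧
    x = Sum.map id (Sigma.mk i) a ∧ y = Sum.map id (Sigma.mk i) b, ?_, ?_⟩
  · rintro x ⟨i, a, b, hab, h1, h2⟩
    have : a = b := by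
      have hinj : Function.Injective (Sum.map (id : V → V) (Sigma.mk i : W i → Σ i, W i)) :=
        Function.Injective.sumMap Function.injective_id sigma_mk_injective
      exact hinj (h1.symm.trans h2)
    subst this
    exact hR i a hab
  · intro f
    have key : ∀ (g : (Σ i, W i) → Fin 3) i a,
        Sum.elim f g (Sum.map id (Sigma.mk i) a) = Sum.elim f (fun w => g ⟨i, w⟩) a := by
      intro g i a
      cases a <;> rfl
    constructor
    · intro h
      choose g hg using fun i => (hQ i f).mp (h i)
      refine ⟨fun w => g w.1 w.2, ?_⟩
      rintro _ _ ⟨i, a, b, hab, rfl, rfl⟩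
      rw [key, key]
      exact hg i a b hab
    · rintro ⟨g, hg⟩ i
      refine (hQ i f).mpr ⟨fun w => g ⟨i, w⟩, ?_⟩
      intro a b hab
      rw [← key, ← key]
      exact hg _ _ ⟨i, a, b, hab, rfl, rfl⟩

lemma PP.and {V : Type} {Q Q' : (V → Fin 3) → Prop} (h : PP Q) (h' : PP Q') :
    PP (fun f => Q f ∧ Q' f) := by
  refine (PP.all (ι := Bool) (Q := fun b => if b then Q else Q') ?_).congr ?_
  · intro b
    cases b
    · simpa using h'
    · simpa using h
  · intro f
    simp [and_comm]

lemma PP.imp {V : Type} {P : Prop} {Q : (V → Fin 3) → Prop} (h : P → PP Q) :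
    PP (fun f => P → Q f) := by
  by_cases hP : P
  · exact (h hP).congr (by simp [hP])
  · exact (PP.all (ι := Empty) (Q := fun _ => Q) (fun i => i.elim)).congr (by simp [hP])

lemma PP.ex {V U : Type} [Finite U] {Q : (V ⊕ U → Fin 3) → Prop} (h : PP Q) :
    PP (fun f : V → Fin 3 => ∃ g : U → Fin 3, Q (Sum.elim f g)) := by
  obtain ⟨W, hW, R, hR, hQ⟩ := h
  let e := Equiv.sumAssoc V U W
  refine ⟨U ⊕ W, inferInstance, fun x y => R (e.symm x) (e.symm y), fun x => hR _, ?_⟩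
  intro f
  have key : ∀ (g : U ⊕ W → Fin 3) x, Sum.elim f g x =
      Sum.elim (Sum.elim f (g ∘ Sum.inl)) (g ∘ Sum.inr) (e.symm x) := by
    rintro g (x | x | x) <;> rfl
  constructor
  · rintro ⟨g, hg⟩
    obtain ⟨g', hg'⟩ := (hQ _).mp hg
    refine ⟨Sum.elim g g', ?_⟩
    intro x y hxy
    rw [key, key]
    exact hg' _ _ hxy
  · rintro ⟨g, hg⟩
    refine ⟨g ∘ Sum.inl, (hQ _).mpr ⟨g ∘ Sum.inr, ?_⟩⟩
    intro x y hxy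
    have := hg (e x) (e y) (by simpa using hxy)
    rw [key, key] at this
    simpa using this

/-- the or-gadget with a literal `x ≠ p k` -/
def Gad (k x p0 p1 p2 s s' : Fin 3) (a b l : Fin 3) : Prop :=
  a ≠ b ∧ a ≠ s' ∧ b ≠ s' ∧ a ≠ s ∧ s' ≠ p2 ∧ (k = 0 → b ≠ x) ∧
    (k ≠ 0 → b ≠ l) ∧ (k ≠ 0 → l ≠ x) ∧ (k = 1 → l ≠ p2) ∧ (k = 2 → l ≠ p1)

instance (k x p0 p1 p2 s s' : Fin 3) (a b l : Fin 3) :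
    Decidable (Gad k x p0 p1 p2 s s' a b l) := by
  unfold Gad; infer_instance

lemma gad_sound : ∀ p0 p1 p2 : Fin 3, p0 ≠ p1 → p0 ≠ p2 → p1 ≠ p2 → ∀ s, (s = p0 ∨ s = p1) →
    ∀ k x s' a b l, Gad k x p0 p1 p2 s s' a b l →
      s' = p0 ∨ (s' = p1 ∧ (s = p1 ∨ x ≠ ![p0, p1, p2] k)) := by
  decide +kernel

lemma gad_complete : ∀ p0 p1 p2 : Fin 3, p0 ≠ p1 → p0 ≠ p2 → p1 ≠ p2 →
    ∀ s, (s = p0 ∨ s = p1) → ∀ k x s',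
      (s' = if s = p1 ∨ x ≠ ![p0, p1, p2] k then p1 else p0) →
      ∃ a b l, Gad k x p0 p1 p2 s s' a b l := by
  decide +kernel

lemma palette_eq (p : Fin 3 → Fin 3) : ![p 0, p 1, p 2] = p := by
  funext i
  fin_cases i <;> rfl

lemma chain {n : ℕ} (f g : Fin n → Fin 3) (p : Fin 3 → Fin 3) (h01 : p 0 ≠ p 1)
    (h02 : p 0 ≠ p 2) (h12 : p 1 ≠ p 2) :
    (∃ s : Fin (n + 1) → Fin 3, (s 0 ≠ p 1 ∧ s 0 ≠ p 2) ∧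
      (s (Fin.last n) ≠ p 0 ∧ s (Fin.last n) ≠ p 2) ∧
      ∀ i : Fin n, ∃ q : Fin 3 → Fin 3,
        Gad (g i) (f i) (p 0) (p 1) (p 2) (s i.castSucc) (s i.succ) (q 0) (q 1) (q 2)) ↔
    ∃ i, f i ≠ p (g i) := by
  have aux : ∀ a b c d : Fin 3, a ≠ b → a ≠ c → b ≠ c → d ≠ a → d ≠ c → d = b := by omega
  constructor
  · rintro ⟨s, ⟨h1, h2⟩, ⟨h3, h4⟩, h5⟩
    have hs0 : s 0 = p 0 := aux _ _ _ _ h01.symm h12 h02 h1 h2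
    have hsl : s (Fin.last n) = p 1 := aux _ _ _ _ h01 h02 h12 h3 h4
    have key : ∀ j, s j = p 0 ∨ (s j = p 1 ∧ ∃ i, f i ≠ p (g i)) := by
      intro j
      induction j using Fin.induction with
      | zero => exact Or.inl hs0
      | succ i ih =>
        obtain ⟨q, hq⟩ := h5 i
        have := gad_sound _ _ _ h01 h02 h12 (s i.castSucc)
          (ih.imp id (fun h => h.1)) _ _ _ _ _ _ hq
        rw [palette_eq] at this
        rcases this with h | ⟨h, h' | h'⟩
        · exact Or.inl h
        · rcases ih with ih | ih
          · exact absurd (ih.symm.trans h') h01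
          · exact Or.inr ⟨h, ih.2⟩
        · exact Or.inr ⟨h, i, h'⟩
    rcases key (Fin.last n) with h | h
    · exact absurd h h3
    · exact h.2
  · intro hex
    classical
    let s : Fin (n + 1) → Fin 3 := fun j =>
      if ∃ i : Fin n, i.castSucc < j ∧ f i ≠ p (g i) then p 1 else p 0
    have hs : ∀ j, s j = p 0 ∨ s j = p 1 := by
      intro j
      by_cases h : ∃ i : Fin n, i.castSucc < j ∧ f i ≠ p (g i)
      · exact Or.inr (if_pos h)
      · exact Or.inl (if_neg h)
    have hs1 : ∀ j, s j = p 1 ↔ ∃ i : Fin n, i.castSucc < j ∧ f i ≠ p (g i) := by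
      intro j
      by_cases h : ∃ i : Fin n, i.castSucc < j ∧ f i ≠ p (g i)
      · exact iff_of_true (if_pos h) h
      · refine iff_of_false ?_ h
        have : s j = p 0 := if_neg h
        rw [this]
        exact h01
    have hs0 : s 0 = p 0 := if_neg (by rintro ⟨i, hi, -⟩; exact absurd hi (Fin.not_lt_zero _))
    have hsl : s (Fin.last n) = p 1 := by
      rw [hs1]
      obtain ⟨i, hi⟩ := hex
      exact ⟨i, Fin.castSucc_lt_last i, hi⟩
    refine ⟨s, ⟨hs0 ▸ h01, hs0 ▸ h02⟩, ⟨hsl ▸ h01.symm, hsl ▸ h12⟩, ?_⟩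
    intro i
    obtain ⟨a, b, l, h⟩ := gad_complete _ _ _ h01 h02 h12 (s i.castSucc) (hs _) (g i) (f i)
      (s i.succ) (by
        rw [palette_eq]
        have hiff : s i.succ = p 1 ↔ (s i.castSucc = p 1 ∨ f i ≠ p (g i)) := by
          rw [hs1, hs1]
          constructor
          · rintro ⟨j, hj, hj'⟩
            have hj2 : j.castSucc ≤ i.castSucc := by
              simp only [Fin.lt_def, Fin.le_def, Fin.val_castSucc, Fin.val_succ] at hj ⊢; omega
            rcases hj2.lt_or_eq with h | h
            · exact Or.inl ⟨j, h, hj'⟩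
            · right
              have : j = i := Fin.castSucc_injective _ h
              exact this ▸ hj'
          · rintro (⟨j, hj, hj'⟩ | h)
            · exact ⟨j, hj.trans Fin.castSucc_lt_succ, hj'⟩
            · exact ⟨i, Fin.castSucc_lt_succ, h⟩
        split_ifs with h
        · exact hiff.mpr h
        · exact (hs _).resolve_right (fun h' => h (hiff.mp h')))
    exact ⟨![a, b, l], h⟩

lemma perm_char {n : ℕ} (C : Set (Fin n → Fin 3))
    (hC : ∀ π : Equiv.Perm (Fin 3), ∀ f ∈ C, π ∘ f ∈ C) (f : Fin n → Fin 3) :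
    f ∈ C ↔ ∃ p : Fin 3 → Fin 3, (p 0 ≠ p 1 ∧ p 0 ≠ p 2 ∧ p 1 ≠ p 2) ∧
      ∀ g : {g // g ∉ C}, ∃ i, f i ≠ p (g.1 i) := by
  constructor
  · intro hf
    refine ⟨id, by decide, ?_⟩
    rintro ⟨g, hg⟩
    by_contra! h
    exact hg ((funext h : f = g) ▸ hf)
  · rintro ⟨p, ⟨h01, h02, h12⟩, h⟩
    by_contra hf
    have hinj : Function.Injective p := by
      have : ∀ p0 p1 p2 : Fin 3, p0 ≠ p1 → p0 ≠ p2 → p1 ≠ p2 →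
        ∀ i j, ![p0, p1, p2] i = ![p0, p1, p2] j → i = j := by decide
      intro i j hij
      have := this _ _ _ h01 h02 h12 i j
      rw [palette_eq] at this
      exact this hij
    let π : Equiv.Perm (Fin 3) := Equiv.ofBijective p (Finite.injective_iff_bijective.mp hinj)
    have hg : (π.symm ∘ f) ∉ C := by
      intro hg
      have := hC π _ hg
      apply hf
      convert this using 1
      funext i
      simp
    obtain ⟨i, hi⟩ := h ⟨_, hg⟩
    exact hi (Equiv.apply_symm_apply π (f i)).symm

lemma pp_main {n : ℕ} (C : Set (Fin n → Fin 3))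
    (hC : ∀ π : Equiv.Perm (Fin 3), ∀ f ∈ C, π ∘ f ∈ C) : PP (fun f => f ∈ C) := by
  have hgad : ∀ (k : Fin 3) (i : Fin n), PP (V := ((Fin n ⊕ Fin 3) ⊕ Fin (n + 1)) ⊕ Fin 3)
      (fun e => Gad k (e (.inl (.inl (.inl i)))) (e (.inl (.inl (.inr 0))))
        (e (.inl (.inl (.inr 1)))) (e (.inl (.inl (.inr 2)))) (e (.inl (.inr i.castSucc)))
        (e (.inl (.inr i.succ))) (e (.inr 0)) (e (.inr 1)) (e (.inr 2))) := by
    intro k i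
    unfold Gad
    refine .and (.neq (by simp)) <| .and (.neq (by simp)) <| .and (.neq (by simp)) <|
      .and (.neq (by simp)) <| .and (.neq (by simp)) <| .and (.imp fun _ => .neq (by simp)) <|
      .and (.imp fun _ => .neq (by simp)) <| .and (.imp fun _ => .neq (by simp)) <|
      .and (.imp fun _ => .neq (by simp)) (.imp fun _ => .neq (by simp))
  have h1 := fun g : {g : Fin n → Fin 3 // g ∉ C} =>
    (PP.and (.and (.neq (x := Sum.inr 0) (y := .inl (.inr 1)) (by simp))
      (.neq (x := Sum.inr 0) (y := .inl (.inr 2)) (by simp)))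
    (PP.and (.and (.neq (x := Sum.inr (Fin.last n)) (y := .inl (.inr 0)) (by simp))
      (.neq (x := Sum.inr (Fin.last n)) (y := .inl (.inr 2)) (by simp)))
    (PP.all (fun i : Fin n => (hgad (g.1 i) i).ex)))).ex
  have h2 := (PP.and (.and (.neq (x := Sum.inr 0) (y := Sum.inr 1) (by simp))
    (.and (.neq (x := Sum.inr 0) (y := Sum.inr 2) (by simp))
      (.neq (x := Sum.inr 1) (y := Sum.inr 2) (by simp)))) (PP.all h1)).ex
  refine h2.congr ?_
  intro f
  rw [perm_char C hC]
  refine exists_congr fun p => ?_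
  refine and_congr_right ?_
  rintro ⟨h01, h02, h12⟩
  refine forall_congr' fun g => ?_
  exact (chain f g.1 p h01 h02 h12).symm

end RR
namespace RR

lemma good_of_closed (n : ℕ) (C : Set (Fin n → Fin 3))
    (hC : ∀ π : Equiv.Perm (Fin 3), ∀ f ∈ C, π ∘ f ∈ C) :
    ∃ (N : ℕ) (G : SimpleGraph ℕ) (L : List ℕ), n + 2 ≤ N ∧
      (∀ x y, G.Adj x y → 2 ≤ x ∧ x < N) ∧ HasCert N (CA n G) L ∧
      ∀ f, f ∈ C ↔ ∃ c : ℕ → Fin 3, IsProperColoring G c ∧ ∀ i : Fin n, c (i + 2) = f i := by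
  obtain ⟨W, hW, R, hR, hQ⟩ := pp_main C hC
  obtain ⟨k, ⟨e⟩⟩ := Finite.exists_equiv_fin W
  let num : Fin n ⊕ W → ℕ := Sum.elim (fun i => (i : ℕ)) (fun w => n + (e w : ℕ))
  have hnum : ∀ x, num x < n + k := by
    rintro (i | w)
    · simp only [num, Sum.elim_inl]; omega
    · simp only [num, Sum.elim_inr]; omega
  have hinj : Function.Injective num := by
    rintro (i | w) (j | v) h <;> simp only [num, Sum.elim_inl, Sum.elim_inr] at h
    · exact congrArg _ (Fin.ext h)
    · omega
    · omega
    · exact congrArg _ (e.injective (Fin.ext (by omega)))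
  let E : List (ℕ × ℕ) :=
    (Set.toFinite {q : (Fin n ⊕ W) × (Fin n ⊕ W) | R q.1 q.2}).toFinset.toList.map
      (fun q => (num q.1, num q.2))
  have hE : ∀ q, q ∈ E ↔ ∃ x y, R x y ∧ q = (num x, num y) := by
    intro q
    simp only [E, List.mem_map, Finset.mem_toList, Set.Finite.mem_toFinset, Set.mem_ofPred_eq,
      Prod.exists]
    exact ⟨fun ⟨x, y, h, h'⟩ => ⟨x, y, h, h'.symm⟩, fun ⟨x, y, h, h'⟩ => ⟨x, y, h, h'.symm⟩⟩
  have hgood := goodE_graph n k E (by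
    intro q hq
    obtain ⟨x, y, hxy, rfl⟩ := (hE q).mp hq
    refine ⟨hnum x, hnum y, fun h => ?_⟩
    have := hinj h
    subst this
    exact hR x hxy)
  obtain ⟨N, G, L, -, -, -, h4, h5, h6, h7⟩ := hgood
  refine ⟨N, G, _, h4, h5, h6, ?_⟩
  intro f
  have hiff : f ∈ C ↔ ∃ env : ℕ → Fin 3, (∀ i : Fin n, env i = f i) ∧
      ∀ q ∈ E, env q.1 ≠ env q.2 := by
    refine (hQ f).trans ?_
    constructor
    · rintro ⟨g, hg⟩
      have hex : ∀ x, Function.extend num (Sum.elim f g) (fun _ => 0) (num x)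
          = Sum.elim f g x := fun x => hinj.extend_apply _ _ x
      refine ⟨Function.extend num (Sum.elim f g) (fun _ => 0), fun i => hex (Sum.inl i), ?_⟩
      intro q hq
      obtain ⟨x, y, hxy, rfl⟩ := (hE q).mp hq
      rw [hex, hex]
      exact hg x y hxy
    · rintro ⟨env, he, hne⟩
      have hel : ∀ x, Sum.elim f (fun w => env (num (Sum.inr w))) x = env (num x) := by
        rintro (i | w)
        · exact (he i).symm
        · rfl
      refine ⟨fun w => env (num (Sum.inr w)), ?_⟩
      intro x y hxy
      rw [hel, hel]
      exact hne _ ((hE _).mpr ⟨x, y, hxy, rfl⟩)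
  rw [hiff]
  constructor
  · rintro ⟨env, h1, h2⟩
    obtain ⟨c, hc, hr, -⟩ := (h7 f _).mp ⟨env, h1, h2, rfl⟩
    exact ⟨c, hc, hr⟩
  · rintro ⟨c, hc, hr⟩
    obtain ⟨env, h1, h2, -⟩ := (h7 f _).mpr ⟨c, hc, hr, rfl⟩
    exact ⟨env, h1, h2⟩

lemma connected_image {V V' : Type*} {G : SimpleGraph V} {H : SimpleGraph V'} (φ : V → V')
    (hφ : ∀ x y, G.Adj x y → H.Adj (φ x) (φ y)) {S : Set V} (hS : (G.induce S).Connected) :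
    (H.induce (φ '' S)).Connected := by
  let F : G.induce S →g H.induce (φ '' S) :=
    ⟨fun x => ⟨φ x, x, x.2, rfl⟩, fun {a b} h => hφ a b h⟩
  refine hS.map F ?_
  rintro ⟨_, x, hx, rfl⟩
  exact ⟨⟨x, hx⟩, rfl⟩

end RR

/-- For every finite set `X` (wlog `Fin n`) and every set `C` of 3-colorings
of `X` (closed under permutations of the three colors), there is a graph
`G ⊇ X` which is `X`-rooted-`K₄`-minor-free and `K₅`-minor-free and realizes
`C`: `f : X → {1,2,3}` extends to a proper 3-coloring of `G` iff `f ∈ C`. -/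
theorem rooted_realization_three (n : ℕ) (C : Set (Fin n → Fin 3))
    (hC : ∀ π : Equiv.Perm (Fin 3), ∀ f ∈ C, π ∘ f ∈ C) :
    ∃ (N : ℕ) (G : SimpleGraph (Fin n ⊕ Fin N)),
      ¬ HasRootedCliqueMinor G (Set.range Sum.inl) 4 ∧
      ¬ HasCliqueMinor G 5 ∧
      ∀ f : Fin n → Fin 3,
        (∃ c : (Fin n ⊕ Fin N) → Fin 3, IsProperColoring G c ∧
          ∀ i : Fin n, c (Sum.inl i) = f i) ↔ f ∈ C := by
  obtain ⟨N, G, L, hN, hG, hcert, hcol⟩ := RR.good_of_closed n C hC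
  let φ : Fin n ⊕ Fin (N - (n + 2)) → ℕ :=
    Sum.elim (fun i => (i : ℕ) + 2) (fun j => n + 2 + (j : ℕ))
  have hφ2 : ∀ x, 2 ≤ φ x := by
    rintro (i | j) <;> simp only [φ, Sum.elim_inl, Sum.elim_inr] <;> omega
  have hinj : Function.Injective φ := by
    rintro (i | w) (j | v) h <;> simp only [φ, Sum.elim_inl, Sum.elim_inr] at h
    · exact congrArg _ (Fin.ext (by omega))
    · omega
    · omega
    · exact congrArg _ (Fin.ext (by omega))
  have hsurj : ∀ v, 2 ≤ v → v < N → ∃ x, φ x = v := by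
    intro v h2 hv
    by_cases h : v < n + 2
    · exact ⟨Sum.inl ⟨v - 2, by omega⟩, by simp only [φ, Sum.elim_inl]; omega⟩
    · exact ⟨Sum.inr ⟨v - (n + 2), by omega⟩, by simp only [φ, Sum.elim_inr]; omega⟩
  refine ⟨N - (n + 2), G.comap φ, ?_, ?_, ?_⟩
  · rintro ⟨μ, h1, h2, h3⟩
    let H : SimpleGraph ℕ := SimpleGraph.fromRel (RR.CA n G)
    have hsymm : ∀ x y, RR.CA n G x y → RR.CA n G y x := by
      intro x y h
      rcases h with h | h | h
      · exact Or.inl h.symm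
      · exact Or.inr (Or.inr h)
      · exact Or.inr (Or.inl h)
    have hHC : ∀ x y, H.Adj x y → RR.CA n G x y := by
      intro x y h
      rcases (SimpleGraph.fromRel_adj _ _ _).mp h with ⟨-, h | h⟩
      · exact h
      · exact hsymm _ _ h
    have hGH : ∀ x y, (G.comap φ).Adj x y → H.Adj (φ x) (φ y) := by
      intro x y h
      exact (SimpleGraph.fromRel_adj _ _ _).mpr
        ⟨fun e => h.ne (hinj e), Or.inl (Or.inl h)⟩
    have hroot : ∀ i : Fin 4, ∃ b ∈ φ '' μ i, H.Adj 1 b := by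
      intro i
      obtain ⟨x, hx, j, rfl⟩ := (h1 i).1
      refine ⟨_, ⟨_, hx, rfl⟩, (SimpleGraph.fromRel_adj _ _ _).mpr ⟨?_, Or.inl (Or.inr
        (Or.inl ⟨rfl, hφ2 _, ?_⟩))⟩⟩
      · have := hφ2 (Sum.inl j)
        omega
      · simp only [φ, Sum.elim_inl]; omega
    have h1not : ∀ i : Fin 4, Disjoint ({1} : Set ℕ) (φ '' μ i) := by
      intro i
      rw [Set.disjoint_singleton_left]
      rintro ⟨x, -, hx⟩
      have := hφ2 x
      omega
    apply hcert.noK5 H hHC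
    refine ⟨Fin.cons {1} (fun i => φ '' μ i), ?_, ?_, ?_⟩
    · intro i
      refine Fin.cases ?_ (fun i => ?_) i
      · refine ⟨⟨1, rfl⟩, ?_⟩
        have : Nonempty ({1} : Set ℕ) := ⟨⟨1, rfl⟩⟩
        exact SimpleGraph.Connected.mk (G := H.induce ({1} : Set ℕ))
          SimpleGraph.Preconnected.of_subsingleton
      · simp only [Fin.cons_succ]
        exact ⟨((h1 i).1.mono Set.inter_subset_left).image φ,
          RR.connected_image φ hGH (h1 i).2⟩
    · intro i j
      refine Fin.cases ?_ (fun i => ?_) i <;> refine Fin.cases ?_ (fun j => ?_) j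
      · intro h; exact absurd rfl h
      · intro _; exact h1not j
      · intro _; exact (h1not i).symm
      · intro h
        exact (Set.disjoint_image_iff hinj).mpr (h2 i j (fun e => h (congrArg _ e)))
    · intro i j
      refine Fin.cases ?_ (fun i => ?_) i <;> refine Fin.cases ?_ (fun j => ?_) j
      · intro h; exact absurd rfl h
      · intro _
        obtain ⟨b, hb, h⟩ := hroot j
        exact ⟨1, rfl, b, hb, h⟩
      · intro _
        obtain ⟨b, hb, h⟩ := hroot i
        exact ⟨b, hb, 1, rfl, h.symm⟩
      · intro h
        obtain ⟨a, ha, b, hb, hab⟩ := h3 i j (fun e => h (congrArg _ e))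
        exact ⟨φ a, ⟨a, ha, rfl⟩, φ b, ⟨b, hb, rfl⟩, hGH a b hab⟩
  · rintro ⟨μ, h1, h2, h3⟩
    apply hcert.noK5 G (fun x y h => Or.inl h)
    refine ⟨fun i => φ '' μ i, ?_, ?_, ?_⟩
    · intro i
      exact ⟨(h1 i).1.image φ, RR.connected_image φ (fun x y h => h) (h1 i).2⟩
    · intro i j h
      exact (Set.disjoint_image_iff hinj).mpr (h2 i j h)
    · intro i j h
      obtain ⟨a, ha, b, hb, hab⟩ := h3 i j h
      exact ⟨φ a, ⟨a, ha, rfl⟩, φ b, ⟨b, hb, rfl⟩, hab⟩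
  · intro f
    rw [hcol f]
    constructor
    · rintro ⟨c, hc, hr⟩
      have hex : ∀ x, Function.extend φ c (fun _ => 0) (φ x) = c x :=
        fun x => hinj.extend_apply _ _ x
      refine ⟨Function.extend φ c (fun _ => 0), ?_, fun i => (hex (Sum.inl i)).trans (hr i)⟩
      intro x y hxy
      obtain ⟨a, rfl⟩ := hsurj x (hG x y hxy).1 (hG x y hxy).2
      obtain ⟨b, rfl⟩ := hsurj y (hG y _ hxy.symm).1 (hG y _ hxy.symm).2
      rw [hex, hex]
      exact hc hxy
    · rintro ⟨c, hc, hr⟩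
      exact ⟨fun x => c (φ x), fun x y h => hc h, fun i => hr i⟩
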